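/- arXiv:1406.3669 — 2 statements merged into one kernel-verified Lean document; each statement's English description precedes it below -/
import Mathlib

section
/- Let γ = 6n2^n log n. For each unit vector u of ℝ^n there exists an (n,γ)-system P: [0,∞) → ℝ^n such that sup_{q ≥ 0} ‖P(q) − L_u(q)‖_∞ ≤ γ, where L_u(q) = (log λ_1(C_u(e^q)), …, log λ_n(C_u(e^q))). -/
open scoped RealInnerProductSpace Pointwise
open Finset

noncomputable section

/-- The `j`-th successive minimum of `C` with respect to the lattice `L`. -/
def minkMin {V : Type*} [AddCommGroup V] [Module ℝ V]
    (L : Set V) (C : Set V) (j : ℕ) : ℝ :=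
  sInf {r : ℝ | 0 < r ∧ ∃ t : Finset V, ↑t ⊆ L ∩ (r • C) ∧ j ≤ t.card ∧
    LinearIndependent ℝ (fun v : t => (v : V))}

/-- The lattice `ℤⁿ ⊆ ℝⁿ`. -/
def intLattice (n : ℕ) : Set (EuclideanSpace ℝ (Fin n)) := {x | ∀ j, ∃ m : ℤ, x j = m}

/-- The convex body `C_u(Q) = {x : ‖x‖ ≤ 1, |x·u| ≤ Q⁻¹}`. -/
def bodyC {n : ℕ} (u : EuclideanSpace ℝ (Fin n)) (Q : ℝ) :
    Set (EuclideanSpace ℝ (Fin n)) := {x | ‖x‖ ≤ 1 ∧ |⟪x, u⟫| ≤ Q⁻¹}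

/-- The partial sum `M_j = P_1 + ⋯ + P_j`. -/
def Msum {n : ℕ} (P : ℝ → Fin n → ℝ) (j : ℕ) (q : ℝ) : ℝ :=
  ∑ i ∈ Finset.univ.filter (fun i : Fin n => (i : ℕ) < j), P q i

/-- `f` is piecewise linear with slopes `0` and `1` on `[q₀,∞)`: its one-sided
derivatives are `0` or `1`. -/
def Slope01On (f : ℝ → ℝ) (q₀ : ℝ) : Prop :=
  (∀ q, q₀ ≤ q → HasDerivWithinAt f 0 (Set.Ici q) q ∨ HasDerivWithinAt f 1 (Set.Ici q) q) ∧
  (∀ q, q₀ < q → HasDerivWithinAt f 0 (Set.Icc q₀ q) q ∨ HasDerivWithinAt f 1 (Set.Icc q₀ q) q)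

/-- `f` changes slope from `1` to `0` at `q` (within `[q₀,∞)`). -/
def ChangesSlopeOn (f : ℝ → ℝ) (q₀ q : ℝ) : Prop :=
  HasDerivWithinAt f 1 (Set.Icc q₀ q) q ∧ HasDerivWithinAt f 0 (Set.Ici q) q

/-- An `(n,γ)`-system on `[q₀,∞)` (Schmidt–Summerer, Definition 2.6):
(S1) `−γ ≤ P_j ≤ P_{j+1} + γ`; (S2) `P_j(q₁) ≤ P_j(q₂) + γ` for `q₁ ≤ q₂`;
(S3) each `M_j = P_1+⋯+P_j` is continuous piecewise linear with slopes `0,1`;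
(S4) `M_n(q) = q`; (S5) if `M_j` (`j < n`) changes slope from `1` to `0` at
`q > q₀` then `P_{j+1}(q) ≤ P_j(q) + γ`. -/
def IsNSystem (n : ℕ) (γ q₀ : ℝ) (P : ℝ → Fin n → ℝ) : Prop :=
  (∀ q, q₀ ≤ q → ∀ j : Fin n, -γ ≤ P q j) ∧
  (∀ q, q₀ ≤ q → ∀ j : Fin n, ∀ h : (j : ℕ) + 1 < n, P q j ≤ P q ⟨(j : ℕ) + 1, h⟩ + γ) ∧
  (∀ j : Fin n, ∀ q₁ q₂, q₀ ≤ q₁ → q₁ ≤ q₂ → P q₁ j ≤ P q₂ j + γ) ∧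
  (∀ j, j ≤ n → ContinuousOn (Msum P j) (Set.Ici q₀) ∧ Slope01On (Msum P j) q₀) ∧
  (∀ q, q₀ ≤ q → Msum P n q = q) ∧
  (∀ j : ℕ, ∀ hj1 : 1 ≤ j, ∀ hj : j < n, ∀ q, q₀ < q →
    ChangesSlopeOn (Msum P j) q₀ q →
      P q ⟨j, hj⟩ ≤ P q ⟨j - 1, by omega⟩ + γ)

/-- If a nondegenerate real lattice in `ℝʲ` has no nonzero vector of Euclidean norm less than `1`,
then its covolume is at least `j ^ (-j / 2)`. -/
lemma one_le_pow_mul_det_sq {j : ℕ} (A : Matrix (Fin j) (Fin j) ℝ) (hA : A.det ≠ 0)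
    (h : ∀ z : Fin j → ℤ, z ≠ 0 → 1 ≤ ∑ k, (∑ i, (z i : ℝ) * A i k) ^ 2) :
    1 ≤ (j : ℝ) ^ j * A.det ^ 2 := by
  rcases Nat.eq_zero_or_pos j with rfl | hj
  · simp
  by_contra! hlt
  have hj' : (0 : ℝ) < j := by exact_mod_cast hj
  have hli : LinearIndependent ℝ A.row :=
    Matrix.linearIndependent_rows_iff_isUnit.2 ((Matrix.isUnit_iff_isUnit_det A).2 hA.isUnit)
  have : Nonempty (Fin j) := ⟨⟨0, hj⟩⟩
  let b : Module.Basis (Fin j) ℝ (Fin j → ℝ) := basisOfLinearIndependentOfCardEqFinrank hli (by simp)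
  have hb : ∀ i, b i = A i := fun i =>
    congrFun (coe_basisOfLinearIndependentOfCardEqFinrank hli _) i
  have hbA : Matrix.of b = A := by ext i k; simp [hb]
  set r : ℝ := 1 / √j with hr
  have hr0 : 0 < r := by positivity
  have hr2 : r ^ 2 * j = 1 := by
    rw [hr, div_pow, Real.sq_sqrt hj'.le]; field_simp
  have hdet : |A.det| < r ^ j := by
    refine lt_of_pow_lt_pow_left₀ 2 (by positivity) ?_
    rw [sq_abs, ← pow_mul, mul_comm j 2, pow_mul]
    have h1 : (r ^ 2) ^ j * (j : ℝ) ^ j = 1 := by rw [← mul_pow, hr2, one_pow]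
    have h2 : (0 : ℝ) < (j : ℝ) ^ j := by positivity
    nlinarith
  have hvol : MeasureTheory.volume (ZSpan.fundamentalDomain b) * 2 ^ Module.finrank ℝ (Fin j → ℝ)
      < MeasureTheory.volume (Metric.ball (0 : Fin j → ℝ) r) := by
    rw [ZSpan.volume_fundamentalDomain, hbA, Real.volume_pi_ball _ hr0]
    simp only [Module.finrank_fintype_fun_eq_card, Fintype.card_fin]
    have : (2 : ENNReal) ^ j = ENNReal.ofReal (2 ^ j) := by
      rw [ENNReal.ofReal_pow (by norm_num)]; simp
    rw [this, ← ENNReal.ofReal_mul (abs_nonneg _)]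
    refine (ENNReal.ofReal_lt_ofReal_iff (by positivity)).2 ?_
    rw [mul_pow, mul_comm]
    gcongr
  have : Countable (Submodule.span ℤ (Set.range b)).toAddSubgroup :=
    inferInstanceAs (Countable (Submodule.span ℤ (Set.range b)))
  obtain ⟨x, hx0, hx⟩ :=
    MeasureTheory.exists_ne_zero_mem_lattice_of_measure_mul_two_pow_lt_measure
      (ZSpan.isAddFundamentalDomain' b MeasureTheory.volume)
      (s := Metric.ball (0 : Fin j → ℝ) r) (by simp) (convex_ball _ _) hvol
  obtain ⟨z, hz⟩ := (Submodule.mem_span_range_iff_exists_fun ℤ).1 x.2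
  have hz0 : z ≠ 0 := by
    rintro rfl
    exact hx0 (Subtype.ext (by simpa using hz.symm))
  have hxk : ∀ k, (∑ i, (z i : ℝ) * A i k) = (x : Fin j → ℝ) k := fun k => by
    simp [← hz, hb]
  have hlt2 : ∑ k, (∑ i, (z i : ℝ) * A i k) ^ 2 < ∑ _k : Fin j, r ^ 2 := by
    refine Finset.sum_lt_sum_of_nonempty Finset.univ_nonempty fun k _ => ?_
    rw [hxk, sq_lt_sq, abs_of_pos hr0]
    have := (norm_le_pi_norm (x : Fin j → ℝ) k).trans_lt (by simpa using hx)
    simpa using this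
  have := h z hz0
  simp only [sum_const, card_univ, Fintype.card_fin, nsmul_eq_mul] at hlt2
  linarith

section Gram

variable {E : Type*} [NormedAddCommGroup E] [InnerProductSpace ℝ E]

lemma det_gram_eq_det_sq {j : ℕ} (b : OrthonormalBasis (Fin j) ℝ E) (v : Fin j → E) :
    (Matrix.gram ℝ v).det = (b.toBasis.det v) ^ 2 := by
  rw [Matrix.gram_eq_conjTranspose_mul b v, Matrix.det_mul, Matrix.det_conjTranspose, sq]
  have : (Matrix.of fun i k => b.repr (v k) i) = b.toBasis.toMatrix v := by
    ext i k; simp [Module.Basis.toMatrix_apply]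
  simp [this, Module.Basis.det_apply]

lemma det_gram_pos {j : ℕ} {v : Fin j → E} (hv : LinearIndependent ℝ v) :
    0 < (Matrix.gram ℝ v).det :=
  (Matrix.posDef_gram_of_linearIndependent hv).det_pos

/-- Hadamard's inequality for Gram determinants. -/
lemma det_gram_le_prod_norm_sq {j : ℕ} {v : Fin j → E} (hv : LinearIndependent ℝ v) :
    (Matrix.gram ℝ v).det ≤ ∏ i, ‖v i‖ ^ 2 := by
  let F := Submodule.span ℝ (Set.range v)
  let v' : Fin j → F := fun i => ⟨v i, Submodule.subset_span ⟨i, rfl⟩⟩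
  have hfr : Module.finrank ℝ F = Fintype.card (Fin j) := finrank_span_eq_card hv
  have hg : Matrix.gram ℝ v = Matrix.gram ℝ v' := rfl
  have : FiniteDimensional ℝ F := FiniteDimensional.span_of_finite ℝ (Set.finite_range v)
  let b := InnerProductSpace.gramSchmidtOrthonormalBasis hfr v'
  have hb : b.toBasis.det v' = ∏ i, ⟪b i, v' i⟫ :=
    InnerProductSpace.gramSchmidtOrthonormalBasis_det hfr v'
  rw [hg, det_gram_eq_det_sq b, hb, ← Finset.prod_pow]
  refine Finset.prod_le_prod (fun i _ => sq_nonneg _) fun i _ => ?_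
  rw [← sq_abs]
  gcongr
  have := abs_real_inner_le_norm (b i) (v' i)
  rwa [b.norm_eq_one, one_mul] at this

/-- Gram matrices transform by congruence under a change of vectors. -/
lemma gram_sum_smul {j : ℕ} (C : Matrix (Fin j) (Fin j) ℝ) (w : Fin j → E) :
    Matrix.gram ℝ (fun i => ∑ k, C i k • w k) = C * Matrix.gram ℝ w * C.transpose := by
  ext i l
  simp only [Matrix.gram_apply, sum_inner, inner_sum, inner_smul_left, inner_smul_right,
    Matrix.mul_apply, Matrix.transpose_apply, Finset.sum_mul, Finset.mul_sum, RCLike.conj_to_real]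
  refine Finset.sum_congr rfl fun a _ => Finset.sum_congr rfl fun b _ => ?_
  ring

end Gram

section Minima

variable {E : Type*} [NormedAddCommGroup E] [InnerProductSpace ℝ E]

/-- `w` successively realizes the minima of the norm on `Λ`. -/
structure IsMinimaSystem (Λ : Set E) {k : ℕ} (w : Fin k → E) : Prop where
  mem : ∀ i, w i ∈ Λ
  linInd : LinearIndependent ℝ w
  le : ∀ i, ∀ y ∈ Λ, y ∉ Submodule.span ℝ (w '' Set.Iio i) → ‖w i‖ ≤ ‖y‖

lemma IsMinimaSystem.monotone {Λ : Set E} {k : ℕ} {w : Fin k → E} (hw : IsMinimaSystem Λ w) :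
    Monotone fun i => ‖w i‖ := fun i l hil =>
  hw.le i _ (hw.mem l) (hw.linInd.notMem_span_image (by simpa using hil))

lemma IsMinimaSystem.le_of_lt_finrank {Λ : Set E} {k : ℕ} {w : Fin k → E}
    (hw : IsMinimaSystem Λ w) (i : Fin k) {Y : Set E} (hY : Y ⊆ Λ) {R : ℝ}
    (hR : ∀ y ∈ Y, ‖y‖ ≤ R) (hi : (i : ℕ) < Module.finrank ℝ (Submodule.span ℝ Y)) :
    ‖w i‖ ≤ R := by
  classical
  by_contra! hlt
  have hsub : Submodule.span ℝ Y ≤ Submodule.span ℝ (w '' Set.Iio i) := by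
    refine Submodule.span_le.2 fun y hy => ?_
    by_contra hy'
    exact absurd ((hw.le i y (hY hy) hy').trans (hR y hy)) (not_le.2 hlt)
  have hfin : (w '' Set.Iio i).Finite := Set.toFinite _
  have : FiniteDimensional ℝ (Submodule.span ℝ (w '' Set.Iio i)) :=
    FiniteDimensional.span_of_finite ℝ hfin
  have h1 := Submodule.finrank_mono hsub
  have h2 : Module.finrank ℝ (Submodule.span ℝ (w '' Set.Iio i)) ≤ i := by
    have hc : w '' Set.Iio i = ↑((Finset.Iio i).image w) := by simp
    rw [hc]
    refine (finrank_span_finset_le_card _).trans (Finset.card_image_le.trans ?_)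
    simp
  omega

lemma exists_isMinimaSystem {Λ : Set E} (hΛ : ∀ R : ℝ, {y ∈ Λ | ‖y‖ ≤ R}.Finite) (k : ℕ)
    (hk : k ≤ Module.finrank ℝ (Submodule.span ℝ Λ)) :
    ∃ w : Fin k → E, IsMinimaSystem Λ w := by
  induction k with
  | zero => exact ⟨Fin.elim0, fun i => i.elim0, linearIndependent_empty_type, fun i => i.elim0⟩
  | succ k ih =>
    obtain ⟨w, hw⟩ := ih (by omega)
    obtain ⟨y₀, hy₀, hy₀'⟩ : ∃ y ∈ Λ, y ∉ Submodule.span ℝ (Set.range w) := by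
      by_contra! h
      have : FiniteDimensional ℝ (Submodule.span ℝ (Set.range w)) :=
        FiniteDimensional.span_of_finite ℝ (Set.finite_range w)
      have h1 := Submodule.finrank_mono (Submodule.span_le.2 h)
      have h2 := finrank_range_le_card (R := ℝ) (b := w)
      rw [Set.finrank] at h2
      simp only [Fintype.card_fin] at h2
      omega
    let s : Set E := {y | (y ∈ Λ ∧ ‖y‖ ≤ ‖y₀‖) ∧ y ∉ Submodule.span ℝ (Set.range w)}
    have hs : s.Finite := (hΛ ‖y₀‖).subset fun y hy => hy.1
    obtain ⟨x, hx, hmin⟩ := Set.exists_min_image s norm hs ⟨y₀, ⟨hy₀, le_rfl⟩, hy₀'⟩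
    refine ⟨Fin.snoc w x, ?_, linearIndependent_finSnoc.2 ⟨hw.linInd, hx.2⟩, ?_⟩
    · intro i
      refine Fin.lastCases ?_ (fun i => ?_) i
      · simpa using hx.1.1
      · simpa using hw.mem i
    · intro i
      refine Fin.lastCases ?_ (fun i => ?_) i
      · intro y hy hy'
        have himg : (Fin.snoc w x : Fin (k + 1) → E) '' Set.Iio (Fin.last k) = Set.range w := by
          ext e
          constructor
          · rintro ⟨l, hl, rfl⟩
            obtain ⟨l, rfl⟩ := Fin.exists_castSucc_eq.2 (ne_of_lt (Set.mem_Iio.1 hl))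
            exact ⟨l, by simp⟩
          · rintro ⟨l, rfl⟩
            exact ⟨l.castSucc, Fin.castSucc_lt_last l, by simp⟩
        rw [himg] at hy'
        rw [Fin.snoc_last]
        rcases le_total ‖y‖ ‖y₀‖ with h | h
        · exact hmin y ⟨⟨hy, h⟩, hy'⟩
        · exact hx.1.2.trans h
      · intro y hy hy'
        have himg : (Fin.snoc w x : Fin (k + 1) → E) '' Set.Iio i.castSucc = w '' Set.Iio i := by
          ext e
          constructor
          · rintro ⟨l, hl, rfl⟩
            obtain ⟨l, rfl⟩ := Fin.exists_castSucc_eq.2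
              (ne_of_lt (lt_trans (Set.mem_Iio.1 hl) (Fin.castSucc_lt_last i)))
            exact ⟨l, by simpa using hl, by simp⟩
          · rintro ⟨l, hl, rfl⟩
            exact ⟨l.castSucc, by simpa using hl, by simp⟩
        rw [himg] at hy'
        rw [Fin.snoc_castSucc]
        exact hw.le i y hy hy'

/-- In the orthonormal basis adapted to a minima system, rescaling the axes by the minima makes
every nonzero lattice vector have norm at least `1`. -/
lemma IsMinimaSystem.one_le_sum {j : ℕ} {Λ : Set E} {w : Fin j → E} (hw : IsMinimaSystem Λ w)
    (b : OrthonormalBasis (Fin j) ℝ E) (hb : ∀ i l, i < l → ⟪b l, w i⟫ = 0)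
    {y : E} (hy : y ∈ Λ) (hy0 : y ≠ 0) : 1 ≤ ∑ k, (⟪b k, y⟫ / ‖w k‖) ^ 2 := by
  have hfr : Module.finrank ℝ E = j := by simpa using Module.finrank_eq_card_basis b.toBasis
  have hpos : ∀ i, 0 < ‖w i‖ := fun i => norm_pos_iff.2 (hw.linInd.ne_zero i)
  let bw : Module.Basis (Fin j) ℝ E := Module.Basis.mk hw.linInd (by
    have : FiniteDimensional ℝ E := b.toBasis.finiteDimensional_of_finite
    exact (hw.linInd.span_eq_top_of_card_eq_finrank' (by simp [hfr])).ge)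
  have hbw : ∀ i, bw i = w i := fun i => by simp [bw]
  have hsupp : (Finset.univ.filter fun i => bw.repr y i ≠ 0).Nonempty := by
    by_contra h
    rw [Finset.not_nonempty_iff_eq_empty, Finset.filter_eq_empty_iff] at h
    apply hy0
    rw [← bw.sum_repr y]
    refine Finset.sum_eq_zero fun i _ => ?_
    rw [not_not.1 (h (Finset.mem_univ i)), zero_smul]
  obtain ⟨m, hm, hmax⟩ := Finset.exists_max_image _ id hsupp
  have hrep : ∀ i, m < i → bw.repr y i = 0 := fun i hi => by
    by_contra h
    exact absurd (hmax i (by simpa using h)) (not_le.2 hi)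
  have hym : ‖w m‖ ≤ ‖y‖ := by
    refine hw.le m y hy fun hmem => ?_
    have himg : w '' Set.Iio m = bw '' Set.Iio m := Set.image_congr fun i _ => (hbw i).symm
    rw [himg] at hmem
    have h1 := Module.Basis.repr_support_subset_of_mem_span bw (Set.Iio m) hmem
    have h2 : m ∈ (bw.repr y).support := by simpa using hm
    exact absurd (h1 h2) (by simp)
  have hzero : ∀ k, m < k → ⟪b k, y⟫ = 0 := fun k hk => by
    rw [← bw.sum_repr y, inner_sum]
    refine Finset.sum_eq_zero fun i _ => ?_
    rw [inner_smul_right, hbw]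
    rcases lt_or_ge m i with h | h
    · rw [hrep i h, zero_mul]
    · rw [hb i k (h.trans_lt hk), mul_zero]
  calc (1 : ℝ) ≤ ‖y‖ ^ 2 / ‖w m‖ ^ 2 := by
        rw [one_le_div (by have := hpos m; positivity)]
        gcongr
    _ = ∑ k, ⟪b k, y⟫ ^ 2 / ‖w m‖ ^ 2 := by
        rw [← Finset.sum_div, ← b.sum_sq_norm_inner_right y]
        simp
    _ ≤ _ := by
        refine Finset.sum_le_sum fun k _ => ?_
        rw [div_pow]
        rcases lt_or_ge m k with h | h
        · simp [hzero k h]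
        · have h1 : ‖w k‖ ≤ ‖w m‖ := hw.monotone h
          have := hpos k
          gcongr

/-- Minkowski's second theorem for Euclidean lattices, with a weak constant. -/
lemma exists_prod_norm_sq_le {j : ℕ} {Λ : AddSubgroup E}
    (hΛ : ∀ R : ℝ, {y ∈ (Λ : Set E) | ‖y‖ ≤ R}.Finite) {v : Fin j → E}
    (hv : LinearIndependent ℝ v) (hvΛ : ∀ i, v i ∈ Λ) :
    ∃ w : Fin j → E, LinearIndependent ℝ w ∧ (∀ i, w i ∈ Λ) ∧ Monotone (fun i => ‖w i‖) ∧
      Submodule.span ℝ (Set.range w) = Submodule.span ℝ (Set.range v) ∧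
      ∏ i, ‖w i‖ ^ 2 ≤ (j : ℝ) ^ j * (Matrix.gram ℝ v).det := by
  let F := Submodule.span ℝ (Set.range v)
  have : FiniteDimensional ℝ F := FiniteDimensional.span_of_finite ℝ (Set.finite_range v)
  let v' : Fin j → F := fun i => ⟨v i, Submodule.subset_span ⟨i, rfl⟩⟩
  have hfr : Module.finrank ℝ F = Fintype.card (Fin j) := finrank_span_eq_card hv
  have hg : Matrix.gram ℝ v = Matrix.gram ℝ v' := rfl
  let Λ' : Set F := {x | (x : E) ∈ Λ}
  have hv' : LinearIndependent ℝ v' := LinearIndependent.of_comp F.subtype hv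
  have hspan : Submodule.span ℝ Λ' = ⊤ := by
    rw [eq_top_iff, ← hv'.span_eq_top_of_card_eq_finrank' hfr.symm]
    refine Submodule.span_mono ?_
    rintro _ ⟨i, rfl⟩
    exact hvΛ i
  obtain ⟨w, hw⟩ := exists_isMinimaSystem (Λ := Λ') (fun R => by
    refine Set.Finite.of_finite_image ((hΛ R).subset ?_) Subtype.val_injective.injOn
    rintro _ ⟨y, hy, rfl⟩
    exact ⟨hy.1, hy.2⟩) j (by rw [hspan, finrank_top, hfr, Fintype.card_fin])
  have hpos : ∀ i, 0 < ‖w i‖ := fun i => norm_pos_iff.2 (hw.linInd.ne_zero i)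
  let b := InnerProductSpace.gramSchmidtOrthonormalBasis hfr w
  have hb : ∀ i l, i < l → ⟪b l, w i⟫ = 0 := fun i l hil =>
    InnerProductSpace.gramSchmidtOrthonormalBasis_inv_triangular hfr w hil
  have hwE : LinearIndependent ℝ (fun i => (w i : E)) :=
    hw.linInd.map' F.subtype (Submodule.ker_subtype F)
  refine ⟨fun i => w i, hwE, hw.mem, hw.monotone, ?_, ?_⟩
  · refine Submodule.eq_of_le_of_finrank_eq (Submodule.span_le.2 ?_) ?_
    · rintro _ ⟨i, rfl⟩
      exact (w i).2
    · rw [finrank_span_eq_card hwE]; exact hfr.symm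
  · let A : Matrix (Fin j) (Fin j) ℝ := Matrix.of fun i k => ‖w k‖⁻¹ * ⟪b k, v' i⟫
    have hdetA : A.det = (∏ k, ‖w k‖⁻¹) * b.toBasis.det v' := by
      rw [Module.Basis.det_apply, ← Matrix.det_transpose (b.toBasis.toMatrix v'),
        ← Matrix.det_mul_row]
      congr 1
      ext i k
      simp [A, Module.Basis.toMatrix_apply, b.repr_apply_apply]
    have hprod : 0 < ∏ k, ‖w k‖ := Finset.prod_pos fun i _ => hpos i
    have hgram := det_gram_eq_det_sq b v'
    have hgpos := det_gram_pos hv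
    rw [hg] at hgpos
    have hA : A.det ≠ 0 := by
      rw [hdetA]
      refine mul_ne_zero (by rw [Finset.prod_inv_distrib]; positivity) ?_
      intro h
      rw [hgram, h] at hgpos
      simp at hgpos
    have key := one_le_pow_mul_det_sq A hA fun z hz => by
      have hy : (∑ i, z i • v' i) ∈ Λ' := by
        change ((∑ i, z i • v' i : F) : E) ∈ Λ
        rw [Submodule.coe_sum]
        exact sum_mem fun i _ => by simpa using zsmul_mem (hvΛ i) (z i)
      have hy0 : (∑ i, z i • v' i) ≠ 0 := by
        intro h
        apply hz
        have := Fintype.linearIndependent_iff.1 hv' (fun i => (z i : ℝ)) (by simpa only [Int.cast_smul_eq_zsmul] using h)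
        ext i
        exact_mod_cast this i
      refine (hw.one_le_sum b hb hy hy0).trans_eq ?_
      refine Finset.sum_congr rfl fun k _ => ?_
      congr 1
      rw [inner_sum, Finset.sum_div]
      refine Finset.sum_congr rfl fun i _ => ?_
      rw [← Int.cast_smul_eq_zsmul ℝ, inner_smul_right]
      simp only [A, Matrix.of_apply]
      ring
    rw [hdetA, mul_pow, ← hgram, ← hg, Finset.prod_inv_distrib, inv_pow] at key
    rw [Finset.prod_pow]
    have h2 : 0 < (∏ k, ‖w k‖) ^ 2 := by positivity
    calc (∏ i, ‖w i‖) ^ 2 ≤ (∏ i, ‖w i‖) ^ 2 *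
          ((j : ℝ) ^ j * (((∏ i, ‖w i‖) ^ 2)⁻¹ * (Matrix.gram ℝ v).det)) :=
          le_mul_of_one_le_right h2.le key
      _ = _ := by field_simp

end Minima

section Envelope

open Filter Topology

/-- The function that is constant and then of slope `1`, with `exp (2 * hinge p q)` equal to
`max p.1 (exp (2 * q) * p.2)`. -/
def hinge (p : ℝ × ℝ) (q : ℝ) : ℝ := Real.log (max p.1 (Real.exp (2 * q) * p.2)) / 2

/-- The pointwise minimum of the functions `hinge p`, `p ∈ S`. -/
def envelope (S : Set (ℝ × ℝ)) (q : ℝ) : ℝ := sInf ((fun p => hinge p q) '' S)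

/-- The conditions on `S` under which `envelope S` is locally a finite minimum. -/
structure IsHingeFamily (S : Set (ℝ × ℝ)) : Prop where
  nonempty : S.Nonempty
  fst_pos : ∀ p ∈ S, 0 < p.1
  snd_nonneg : ∀ p ∈ S, 0 ≤ p.2
  finite : ∀ R : ℝ, {p ∈ S | p.1 ≤ R}.Finite

lemma hinge_of_le {p : ℝ × ℝ} {q : ℝ} (h : Real.exp (2 * q) * p.2 ≤ p.1) :
    hinge p q = Real.log p.1 / 2 := by rw [hinge, max_eq_left h]

lemma hinge_of_ge {p : ℝ × ℝ} {q : ℝ} (hp : 0 < p.1) (h : p.1 ≤ Real.exp (2 * q) * p.2) :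
    hinge p q = q + Real.log p.2 / 2 := by
  have : 0 < p.2 := pos_of_mul_pos_right (hp.trans_le h) (Real.exp_pos _).le
  rw [hinge, max_eq_right h, Real.log_mul (Real.exp_pos _).ne' this.ne', Real.log_exp]
  ring

lemma hinge_mono {p : ℝ × ℝ} (hp : 0 < p.1) (hp' : 0 ≤ p.2) : Monotone (hinge p) := by
  intro x y hxy
  have : 0 < max p.1 (Real.exp (2 * x) * p.2) := lt_max_of_lt_left hp
  unfold hinge
  gcongr

lemma continuous_hinge {p : ℝ × ℝ} (hp : 0 < p.1) : Continuous (hinge p) := by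
  unfold hinge
  refine Continuous.div_const (Continuous.log (by fun_prop) fun x => ?_) 2
  exact (lt_max_of_lt_left hp).ne'

lemma eventually_exp_mul_lt {a b q : ℝ} (h : Real.exp (2 * q) * b < a) :
    ∀ᶠ x in 𝓝 q, Real.exp (2 * x) * b < a :=
  (Continuous.tendsto (f := fun x => Real.exp (2 * x) * b) (by fun_prop) q).eventually_lt_const h

lemma eventually_lt_exp_mul {a b q : ℝ} (h : a < Real.exp (2 * q) * b) :
    ∀ᶠ x in 𝓝 q, a < Real.exp (2 * x) * b :=
  (Continuous.tendsto (f := fun x => Real.exp (2 * x) * b) (by fun_prop) q).eventually_const_lt h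

lemma hinge_right_germ {p : ℝ × ℝ} (hp : 0 < p.1) (q : ℝ) :
    (Real.exp (2 * q) * p.2 < p.1 ∧ ∀ᶠ x in 𝓝[≥] q, hinge p x = hinge p q + 0 * (x - q)) ∨
      (p.1 ≤ Real.exp (2 * q) * p.2 ∧ ∀ᶠ x in 𝓝[≥] q, hinge p x = hinge p q + 1 * (x - q)) := by
  rcases lt_or_ge (Real.exp (2 * q) * p.2) p.1 with h | h
  · refine Or.inl ⟨h, ?_⟩
    filter_upwards [nhdsWithin_le_nhds (eventually_exp_mul_lt h)] with x hx
    rw [hinge_of_le hx.le, hinge_of_le h.le]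
    ring
  · refine Or.inr ⟨h, ?_⟩
    have hp2 : 0 < p.2 := pos_of_mul_pos_right (hp.trans_le h) (Real.exp_pos _).le
    filter_upwards [self_mem_nhdsWithin] with x hx
    have hx' : p.1 ≤ Real.exp (2 * x) * p.2 := h.trans (by have := Set.mem_Ici.1 hx; gcongr)
    rw [hinge_of_ge hp hx', hinge_of_ge hp h]
    ring

lemma hinge_left_germ {p : ℝ × ℝ} (hp : 0 < p.1) (hp' : 0 ≤ p.2) (q : ℝ) :
    (Real.exp (2 * q) * p.2 ≤ p.1 ∧ ∀ᶠ x in 𝓝[≤] q, hinge p x = hinge p q + 0 * (x - q)) ∨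
      (p.1 < Real.exp (2 * q) * p.2 ∧ ∀ᶠ x in 𝓝[≤] q, hinge p x = hinge p q + 1 * (x - q)) := by
  rcases le_or_gt (Real.exp (2 * q) * p.2) p.1 with h | h
  · refine Or.inl ⟨h, ?_⟩
    filter_upwards [self_mem_nhdsWithin] with x hx
    have hx' : Real.exp (2 * x) * p.2 ≤ p.1 :=
      le_trans (by have := Set.mem_Iic.1 hx; gcongr) h
    rw [hinge_of_le hx', hinge_of_le h]
    ring
  · refine Or.inr ⟨h, ?_⟩
    filter_upwards [nhdsWithin_le_nhds (eventually_lt_exp_mul h)] with x hx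
    rw [hinge_of_ge hp hx.le, hinge_of_ge hp h.le]
    ring

/-- A finite family of eventually comparable functions has an eventually smallest member. -/
lemma exists_eventually_le {α ι : Type*} {l : Filter α} (f : ι → α → ℝ) {s : Set ι}
    (hs : s.Finite) (hne : s.Nonempty)
    (h : ∀ i ∈ s, ∀ k ∈ s, (∀ᶠ x in l, f i x ≤ f k x) ∨ ∀ᶠ x in l, f k x ≤ f i x) :
    ∃ i ∈ s, ∀ᶠ x in l, ∀ k ∈ s, f i x ≤ f k x := by
  suffices ∃ i ∈ s, ∀ k ∈ s, ∀ᶠ x in l, f i x ≤ f k x by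
    obtain ⟨i, hi, hk⟩ := this
    exact ⟨i, hi, (eventually_all_finite hs).2 hk⟩
  induction s, hs using Set.Finite.induction_on with
  | empty => exact absurd hne Set.not_nonempty_empty
  | @insert a s ha hs ih =>
    rcases s.eq_empty_or_nonempty with rfl | hs'
    · exact ⟨a, by simp, by simp⟩
    · obtain ⟨i, hi, hk⟩ := ih hs' fun i hi k hk =>
        h i (Set.mem_insert_of_mem _ hi) k (Set.mem_insert_of_mem _ hk)
      rcases h i (Set.mem_insert_of_mem _ hi) a (Set.mem_insert _ _) with hia | hai
      · refine ⟨i, Set.mem_insert_of_mem _ hi, fun k hk' => ?_⟩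
        rcases Set.mem_insert_iff.1 hk' with rfl | hk'
        · exact hia
        · exact hk k hk'
      · refine ⟨a, Set.mem_insert _ _, fun k hk' => ?_⟩
        rcases Set.mem_insert_iff.1 hk' with rfl | hk'
        · exact Eventually.of_forall fun _ => le_rfl
        · filter_upwards [hai, hk k hk'] with x h1 h2 using h1.trans h2

variable {S : Set (ℝ × ℝ)}

lemma IsHingeFamily.exists_finite (hS : IsHingeFamily S) (q : ℝ) :
    ∃ T ⊆ S, T.Finite ∧ T.Nonempty ∧ ∀ x ≤ q, ∀ p ∈ S, ∃ p' ∈ T, hinge p' x ≤ hinge p x := by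
  obtain ⟨p₀, hp₀⟩ := hS.nonempty
  refine ⟨insert p₀ {p ∈ S | p.1 ≤ Real.exp (2 * hinge p₀ q)}, ?_, (hS.finite _).insert _,
    ⟨p₀, Set.mem_insert _ _⟩, fun x hx p hp => ?_⟩
  · exact Set.insert_subset hp₀ (Set.sep_subset _ _)
  · rcases le_or_gt p.1 (Real.exp (2 * hinge p₀ q)) with h | h
    · exact ⟨p, Set.mem_insert_of_mem _ ⟨hp, h⟩, le_rfl⟩
    · refine ⟨p₀, Set.mem_insert _ _, ?_⟩
      have h1 := hinge_mono (hS.fst_pos p₀ hp₀) (hS.snd_nonneg p₀ hp₀) hx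
      have h2 : 2 * hinge p₀ q < Real.log p.1 := (Real.lt_log_iff_exp_lt (hS.fst_pos p hp)).2 h
      have h3 : Real.log p.1 / 2 ≤ hinge p x := by
        unfold hinge
        have := hS.fst_pos p hp
        gcongr
        exact le_max_left _ _
      linarith

lemma envelope_eq {p : ℝ × ℝ} {q : ℝ} (hp : p ∈ S) (h : ∀ p' ∈ S, hinge p q ≤ hinge p' q) :
    envelope S q = hinge p q :=
  IsLeast.csInf_eq ⟨⟨p, hp, rfl⟩, by rintro _ ⟨p', hp', rfl⟩; exact h p' hp'⟩

lemma IsHingeFamily.exists_eq (hS : IsHingeFamily S) (q : ℝ) :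
    ∃ p ∈ S, envelope S q = hinge p q ∧ ∀ p' ∈ S, hinge p q ≤ hinge p' q := by
  obtain ⟨T, hTS, hT, hne, hT'⟩ := hS.exists_finite q
  obtain ⟨p, hp, hmin⟩ := Set.exists_min_image T (fun p => hinge p q) hT hne
  have : ∀ p' ∈ S, hinge p q ≤ hinge p' q := fun p' hp' => by
    obtain ⟨p'', h1, h2⟩ := hT' q le_rfl p' hp'
    exact (hmin p'' h1).trans h2
  exact ⟨p, hTS hp, envelope_eq (hTS hp) this, this⟩

lemma IsHingeFamily.envelope_le (hS : IsHingeFamily S) {p : ℝ × ℝ} (hp : p ∈ S) (q : ℝ) :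
    envelope S q ≤ hinge p q := by
  obtain ⟨p₀, -, h1, h2⟩ := hS.exists_eq q
  exact h1.trans_le (h2 p hp)

/-- On a one-sided neighbourhood, the envelope coincides with one hinge function. -/
lemma IsHingeFamily.exists_germ (hS : IsHingeFamily S) (q : ℝ) {s : Set ℝ}
    (hs : (∀ x ∈ s, q ≤ x) ∨ ∀ x ∈ s, x ≤ q)
    (hgerm : ∀ p ∈ S, ∃ c : ℝ, ∀ᶠ x in 𝓝[s] q, hinge p x = hinge p q + c * (x - q)) :
    ∃ p ∈ S, envelope S =ᶠ[𝓝[s] q] hinge p := by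
  obtain ⟨T, hTS, hT, hne, hT'⟩ := hS.exists_finite (q + 1)
  obtain ⟨p, hp, hmin⟩ := exists_eventually_le (l := 𝓝[s] q) hinge hT hne (by
    have hlt : ∀ p ∈ T, ∀ p' ∈ T, hinge p q < hinge p' q →
        ∀ᶠ x in 𝓝[s] q, hinge p x ≤ hinge p' x := fun p hp p' hp' h => by
      have h1 := (continuous_hinge (hS.fst_pos p (hTS hp))).tendsto q
      have h2 := (continuous_hinge (hS.fst_pos p' (hTS hp'))).tendsto q
      filter_upwards [nhdsWithin_le_nhds (h1.eventually_lt h2 h)] with x hx using hx.le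
    intro p hp p' hp'
    rcases lt_trichotomy (hinge p q) (hinge p' q) with h | h | h
    · exact Or.inl (hlt p hp p' hp' h)
    · obtain ⟨c, hc⟩ := hgerm p (hTS hp)
      obtain ⟨c', hc'⟩ := hgerm p' (hTS hp')
      rcases hs with hs | hs <;> rcases le_total c c' with hcc | hcc
      · left
        filter_upwards [hc, hc', self_mem_nhdsWithin] with x h1 h2 hx
        nlinarith [hs x hx]
      · right
        filter_upwards [hc, hc', self_mem_nhdsWithin] with x h1 h2 hx
        nlinarith [hs x hx]
      · right
        filter_upwards [hc, hc', self_mem_nhdsWithin] with x h1 h2 hx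
        nlinarith [hs x hx]
      · left
        filter_upwards [hc, hc', self_mem_nhdsWithin] with x h1 h2 hx
        nlinarith [hs x hx]
    · exact Or.inr (hlt p' hp' p hp h))
  refine ⟨p, hTS hp, ?_⟩
  have hle : ∀ᶠ x in 𝓝[s] q, x ≤ q + 1 :=
    nhdsWithin_le_nhds ((eventually_lt_nhds (lt_add_one q)).mono fun _ h => h.le)
  filter_upwards [hmin, hle] with x hx hxq
  refine envelope_eq (hTS hp) fun p' hp' => ?_
  obtain ⟨p'', h1, h2⟩ := hT' x hxq p' hp'
  exact (hx p'' h1).trans h2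

lemma hasDerivWithinAt_of_germ {f : ℝ → ℝ} {q c : ℝ} {s : Set ℝ}
    (h : ∀ᶠ x in 𝓝[s] q, f x = f q + c * (x - q)) : HasDerivWithinAt f c s q := by
  have h1 : HasDerivAt (fun x => f q + c * (x - q)) c q := by
    simpa using (((hasDerivAt_id q).sub_const q).const_mul c).const_add (f q)
  exact h1.hasDerivWithinAt.congr_of_eventuallyEq h (by simp)

lemma IsHingeFamily.right_deriv (hS : IsHingeFamily S) (q : ℝ) :
    ∃ p ∈ S, envelope S q = hinge p q ∧
      ((Real.exp (2 * q) * p.2 < p.1 ∧ HasDerivWithinAt (envelope S) 0 (Set.Ici q) q) ∨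
        HasDerivWithinAt (envelope S) 1 (Set.Ici q) q) := by
  obtain ⟨p, hp, hgerm⟩ := hS.exists_germ q (s := Set.Ici q) (Or.inl fun x hx => hx)
    fun p hp => (hinge_right_germ (hS.fst_pos p hp) q).elim (fun h => ⟨0, h.2⟩) fun h => ⟨1, h.2⟩
  have hq : envelope S q = hinge p q := hgerm.self_of_nhdsWithin Set.self_mem_Ici
  refine ⟨p, hp, hq, (hinge_right_germ (hS.fst_pos p hp) q).imp ?_ ?_⟩
  · exact fun h => ⟨h.1, (hasDerivWithinAt_of_germ h.2).congr_of_eventuallyEq hgerm hq⟩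
  · exact fun h => (hasDerivWithinAt_of_germ h.2).congr_of_eventuallyEq hgerm hq

lemma IsHingeFamily.left_deriv (hS : IsHingeFamily S) (q : ℝ) :
    ∃ p ∈ S, envelope S q = hinge p q ∧
      (HasDerivWithinAt (envelope S) 0 (Set.Iic q) q ∨
        (p.1 < Real.exp (2 * q) * p.2 ∧ HasDerivWithinAt (envelope S) 1 (Set.Iic q) q)) := by
  have hg := fun p hp => hinge_left_germ (hS.fst_pos p hp) (hS.snd_nonneg p hp) q
  obtain ⟨p, hp, hgerm⟩ := hS.exists_germ q (s := Set.Iic q) (Or.inr fun x hx => hx)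
    fun p hp => (hg p hp).elim (fun h => ⟨0, h.2⟩) fun h => ⟨1, h.2⟩
  have hq : envelope S q = hinge p q := hgerm.self_of_nhdsWithin Set.self_mem_Iic
  refine ⟨p, hp, hq, (hg p hp).imp ?_ ?_⟩
  · exact fun h => (hasDerivWithinAt_of_germ h.2).congr_of_eventuallyEq hgerm hq
  · exact fun h => ⟨h.1, (hasDerivWithinAt_of_germ h.2).congr_of_eventuallyEq hgerm hq⟩

lemma IsHingeFamily.slope01On (hS : IsHingeFamily S) (q₀ : ℝ) : Slope01On (envelope S) q₀ := by
  refine ⟨fun q _ => ?_, fun q _ => ?_⟩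
  · obtain ⟨p, -, -, h⟩ := hS.right_deriv q
    exact h.imp_left fun h => h.2
  · obtain ⟨p, -, -, h⟩ := hS.left_deriv q
    exact h.imp (fun h => h.mono Set.Icc_subset_Iic_self) fun h => h.2.mono Set.Icc_subset_Iic_self

lemma IsHingeFamily.continuous (hS : IsHingeFamily S) : Continuous (envelope S) := by
  refine continuous_iff_continuousAt.2 fun q => continuousAt_iff_continuous_left_right.2 ⟨?_, ?_⟩
  · obtain ⟨p, -, -, h⟩ := hS.left_deriv q
    exact h.elim (fun h => h.continuousWithinAt) fun h => h.2.continuousWithinAt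
  · obtain ⟨p, -, -, h⟩ := hS.right_deriv q
    exact h.elim (fun h => h.2.continuousWithinAt) fun h => h.continuousWithinAt

/-- Where the envelope changes slope from `1` to `0`, two essentially different members of the
family realize it. -/
lemma IsHingeFamily.exists_of_changesSlopeOn (hS : IsHingeFamily S) {q₀ q : ℝ} (hq : q₀ < q)
    (h : ChangesSlopeOn (envelope S) q₀ q) :
    ∃ p ∈ S, ∃ p' ∈ S, envelope S q = hinge p q ∧ envelope S q = hinge p' q ∧
      p.1 < Real.exp (2 * q) * p.2 ∧ Real.exp (2 * q) * p'.2 < p'.1 := by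
  obtain ⟨p, hp, hpq, hl⟩ := hS.left_deriv q
  obtain ⟨p', hp', hpq', hr⟩ := hS.right_deriv q
  refine ⟨p, hp, p', hp', hpq, hpq', ?_, ?_⟩
  · rcases hl with hl | hl
    · have := (uniqueDiffOn_Icc hq q (Set.right_mem_Icc.2 hq.le)).eq_deriv _ h.1
        (hl.mono Set.Icc_subset_Iic_self)
      norm_num at this
    · exact hl.1
  · rcases hr with hr | hr
    · exact hr.1
    · have := (uniqueDiffOn_Ici q q Set.self_mem_Ici).eq_deriv _ h.2 hr
      norm_num at this

end Envelope

section Lift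

variable {V : Type*} [NormedAddCommGroup V] [InnerProductSpace ℝ V]

/-- The embedding `x ↦ (x, exp q * ⟪x, u⟫)`, whose norm is equivalent to the gauge of
`bodyC u (exp q)`. -/
def stretch (u : V) (q : ℝ) : V →ₗ[ℝ] WithLp 2 (V × ℝ) where
  toFun x := WithLp.toLp 2 (x, Real.exp q * ⟪x, u⟫)
  map_add' x y := by
    rw [← WithLp.toLp_add, Prod.mk_add_mk, inner_add_left, mul_add]
  map_smul' c x := by
    rw [RingHom.id_apply, ← WithLp.toLp_smul, Prod.smul_mk, inner_smul_left]
    simp [mul_left_comm]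

lemma inner_stretch (u : V) (q : ℝ) (x y : V) :
    ⟪stretch u q x, stretch u q y⟫ = ⟪x, y⟫ + Real.exp (2 * q) * (⟪x, u⟫ * ⟪y, u⟫) := by
  have : Real.exp (2 * q) = Real.exp q * Real.exp q := by rw [← Real.exp_add]; ring_nf
  simp only [stretch, LinearMap.coe_mk, AddHom.coe_mk, WithLp.prod_inner_apply, this]
  simp
  ring

lemma norm_stretch_sq (u : V) (q : ℝ) (x : V) :
    ‖stretch u q x‖ ^ 2 = ‖x‖ ^ 2 + (Real.exp q * |⟪x, u⟫|) ^ 2 := by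
  have : Real.exp (2 * q) = Real.exp q ^ 2 := by rw [← Real.exp_nat_mul]; norm_num
  rw [← real_inner_self_eq_norm_sq, inner_stretch, real_inner_self_eq_norm_sq, this, mul_pow, sq_abs]
  ring

lemma norm_le_norm_stretch (u : V) (q : ℝ) (x : V) : ‖x‖ ≤ ‖stretch u q x‖ := by
  refine le_of_sq_le_sq ?_ (norm_nonneg _)
  rw [norm_stretch_sq]
  exact le_add_of_nonneg_right (sq_nonneg _)

lemma exp_mul_abs_inner_le_norm_stretch (u : V) (q : ℝ) (x : V) :
    Real.exp q * |⟪x, u⟫| ≤ ‖stretch u q x‖ := by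
  refine le_of_sq_le_sq ?_ (norm_nonneg _)
  rw [norm_stretch_sq]
  exact le_add_of_nonneg_left (sq_nonneg _)

lemma stretch_injective (u : V) (q : ℝ) : Function.Injective (stretch u q) := by
  refine (injective_iff_map_eq_zero _).2 fun x hx => norm_le_zero_iff.1 ?_
  simpa [hx] using norm_le_norm_stretch u q x

lemma linearIndependent_stretch (u : V) (q : ℝ) {j : ℕ} {v : Fin j → V}
    (hv : LinearIndependent ℝ v) : LinearIndependent ℝ (stretch u q ∘ v) :=
  hv.map' _ (LinearMap.ker_eq_bot.2 (stretch_injective u q))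

/-- The coefficients of the Gram determinant of `stretch u q ∘ v` as an affine function of
`exp (2 * q)`. -/
def volPair (u : V) {j : ℕ} (v : Fin j → V) : ℝ × ℝ :=
  ((Matrix.gram ℝ v).det, (Matrix.gram ℝ (stretch u 0 ∘ v)).det - (Matrix.gram ℝ v).det)

lemma det_gram_stretch_aux (u : V) (q : ℝ) {j : ℕ} {v : Fin j → V} (hv : LinearIndependent ℝ v) :
    (Matrix.gram ℝ (stretch u q ∘ v)).det = (Matrix.gram ℝ v).det * (1 + Real.exp (2 * q) *
      ((fun i => ⟪v i, u⟫) ⬝ᵥ (Matrix.gram ℝ v)⁻¹.mulVec fun i => ⟪v i, u⟫)) := by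
  have h1 : Matrix.gram ℝ (stretch u q ∘ v) = Matrix.gram ℝ v +
      Matrix.replicateCol Unit (fun i => Real.exp (2 * q) * ⟪v i, u⟫) *
        Matrix.replicateRow Unit (fun i => ⟪v i, u⟫) := by
    ext i k
    rw [Matrix.gram_apply, Function.comp_apply, Function.comp_apply, inner_stretch]
    simp [Matrix.mul_apply, mul_assoc]
  rw [h1, Matrix.det_add_replicateCol_mul_replicateRow (det_gram_pos hv).ne'.isUnit]
  congr 1
  rw [Matrix.det_unique, Matrix.add_apply, Matrix.one_apply_eq, Matrix.mul_assoc, ← Matrix.replicateCol_mulVec,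
    Matrix.replicateRow_mul_replicateCol_apply]
  have h2 : (fun i => Real.exp (2 * q) * ⟪v i, u⟫) = Real.exp (2 * q) • fun i => ⟪v i, u⟫ := rfl
  rw [h2, Matrix.mulVec_smul, dotProduct_smul, smul_eq_mul]

lemma det_gram_stretch (u : V) (q : ℝ) {j : ℕ} {v : Fin j → V} (hv : LinearIndependent ℝ v) :
    (Matrix.gram ℝ (stretch u q ∘ v)).det =
      (volPair u v).1 + Real.exp (2 * q) * (volPair u v).2 := by
  rw [volPair, det_gram_stretch_aux u q hv, det_gram_stretch_aux u 0 hv]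
  simp only [mul_zero, Real.exp_zero]
  ring

lemma volPair_fst_pos (u : V) {j : ℕ} {v : Fin j → V} (hv : LinearIndependent ℝ v) :
    0 < (volPair u v).1 := det_gram_pos hv

lemma volPair_snd_nonneg (u : V) {j : ℕ} {v : Fin j → V} (hv : LinearIndependent ℝ v) :
    0 ≤ (volPair u v).2 := by
  have h := (Matrix.posDef_gram_of_linearIndependent hv).inv.posSemidef.dotProduct_mulVec_nonneg
    fun i => ⟪v i, u⟫
  rw [star_trivial] at h
  rw [volPair, det_gram_stretch_aux u 0 hv]
  have := det_gram_pos hv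
  simp only [mul_zero, Real.exp_zero]
  nlinarith [mul_nonneg this.le h]

lemma volPair_sum_smul (u : V) {j : ℕ} (C : Matrix (Fin j) (Fin j) ℝ) (w : Fin j → V) :
    volPair u (fun i => ∑ k, C i k • w k) = C.det ^ 2 • volPair u w := by
  have h : stretch u 0 ∘ (fun i => ∑ k, C i k • w k) =
      fun i => ∑ k, C i k • (stretch u 0 ∘ w) k := by
    ext i : 1
    simp [map_sum]
  rw [volPair, volPair, h, gram_sum_smul, gram_sum_smul]
  simp only [Matrix.det_mul, Matrix.det_transpose, Prod.smul_mk, smul_eq_mul]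
  ext <;> simp <;> ring

lemma exists_volPair_eq_smul (u : V) {j : ℕ} {v w : Fin j → V}
    (h : ∀ i, v i ∈ Submodule.span ℝ (Set.range w)) :
    ∃ C : Matrix (Fin j) (Fin j) ℝ, (∀ i, v i = ∑ k, C i k • w k) ∧
      volPair u v = C.det ^ 2 • volPair u w := by
  choose c hc using fun i => (Submodule.mem_span_range_iff_exists_fun ℝ).1 (h i)
  refine ⟨Matrix.of c, fun i => (hc i).symm, ?_⟩
  rw [← volPair_sum_smul]
  congr 1
  ext i : 1
  exact (hc i).symm

lemma hinge_volPair_le (u : V) (q : ℝ) {j : ℕ} {v : Fin j → V} (hv : LinearIndependent ℝ v) :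
    hinge (volPair u v) q ≤ Real.log (Matrix.gram ℝ (stretch u q ∘ v)).det / 2 := by
  have h1 := volPair_fst_pos u hv
  have h2 := mul_nonneg (Real.exp_pos (2 * q)).le (volPair_snd_nonneg u hv)
  rw [hinge, det_gram_stretch u q hv]
  have : 0 < max (volPair u v).1 (Real.exp (2 * q) * (volPair u v).2) := lt_max_of_lt_left h1
  gcongr
  exact max_le (by linarith) (by linarith)

lemma log_det_gram_stretch_le (u : V) (q : ℝ) {j : ℕ} {v : Fin j → V}
    (hv : LinearIndependent ℝ v) :
    Real.log (Matrix.gram ℝ (stretch u q ∘ v)).det ≤ 2 * hinge (volPair u v) q + Real.log 2 := by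
  have h1 := volPair_fst_pos u hv
  have : 0 < max (volPair u v).1 (Real.exp (2 * q) * (volPair u v).2) := lt_max_of_lt_left h1
  rw [hinge, mul_div_cancel₀ _ two_ne_zero, ← Real.log_mul this.ne' two_ne_zero]
  refine Real.log_le_log (det_gram_pos (linearIndependent_stretch u q hv)) ?_
  rw [det_gram_stretch u q hv]
  have h3 := le_max_left (volPair u v).1 (Real.exp (2 * q) * (volPair u v).2)
  have h4 := le_max_right (volPair u v).1 (Real.exp (2 * q) * (volPair u v).2)
  linarith

end Lift

section Lattice

variable {n : ℕ}

/-- `intLattice n` as an additive subgroup. -/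
def intSubgroup (n : ℕ) : AddSubgroup (EuclideanSpace ℝ (Fin n)) where
  carrier := intLattice n
  add_mem' {x y} hx hy i := by
    obtain ⟨a, ha⟩ := hx i
    obtain ⟨b, hb⟩ := hy i
    exact ⟨a + b, by simp [ha, hb]⟩
  zero_mem' i := ⟨0, by simp⟩
  neg_mem' {x} hx i := by
    obtain ⟨a, ha⟩ := hx i
    exact ⟨-a, by simp [ha]⟩

lemma finite_intSubgroup_ball (R : ℝ) :
    {y ∈ (intSubgroup n : Set (EuclideanSpace ℝ (Fin n))) | ‖y‖ ≤ R}.Finite := by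
  refine ((Set.Finite.pi' fun _ : Fin n => Set.finite_Icc (-⌈R⌉) ⌈R⌉).image
    fun z : Fin n → ℤ => WithLp.toLp 2 fun i => (z i : ℝ)).subset ?_
  rintro y ⟨hy, hyR⟩
  choose z hz using hy
  refine ⟨z, fun i => ?_, ?_⟩
  · have h := ((PiLp.norm_apply_le y i).trans hyR).trans (Int.le_ceil R)
    rw [hz, Real.norm_eq_abs, abs_le] at h
    exact ⟨by exact_mod_cast h.1, by exact_mod_cast h.2⟩
  · ext i
    simp [hz]

lemma one_le_norm_of_mem_intLattice {y : EuclideanSpace ℝ (Fin n)} (hy : y ∈ intLattice n)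
    (hy0 : y ≠ 0) : 1 ≤ ‖y‖ := by
  obtain ⟨i, hi⟩ : ∃ i, y i ≠ 0 := by
    by_contra! h
    exact hy0 (by ext i; simpa using h i)
  refine le_trans ?_ (PiLp.norm_apply_le y i)
  obtain ⟨m, hm⟩ := hy i
  rw [hm] at hi ⊢
  rw [Real.norm_eq_abs]
  exact_mod_cast Int.one_le_abs (Int.cast_ne_zero.1 hi)

lemma exists_int_det_gram {j : ℕ} {v : Fin j → EuclideanSpace ℝ (Fin n)}
    (hv : ∀ i, v i ∈ intLattice n) : ∃ m : ℤ, (Matrix.gram ℝ v).det = m := by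
  choose z hz using hv
  refine ⟨(Matrix.of fun i k => ∑ l, z k l * z i l).det, ?_⟩
  rw [← eq_intCast (Int.castRingHom ℝ), RingHom.map_det]
  congr 1
  ext i k
  simp [PiLp.inner_apply, hz]

lemma basisFun_mem_intLattice (i : Fin n) : EuclideanSpace.basisFun (Fin n) ℝ i ∈ intLattice n := by
  intro k
  refine ⟨if k = i then 1 else 0, ?_⟩
  by_cases h : k = i <;> simp [h]

/-- The coefficient pairs of all linearly independent integral `j`-tuples. -/
def volSet (u : EuclideanSpace ℝ (Fin n)) (j : ℕ) : Set (ℝ × ℝ) :=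
  {p | ∃ v : Fin j → EuclideanSpace ℝ (Fin n), (∀ i, v i ∈ intLattice n) ∧
    LinearIndependent ℝ v ∧ p = volPair u v}

lemma finite_volSet (u : EuclideanSpace ℝ (Fin n)) (j : ℕ) (R : ℝ) :
    {p ∈ volSet u j | p.1 ≤ R}.Finite := by
  let B := {y ∈ (intSubgroup n : Set (EuclideanSpace ℝ (Fin n))) | ‖y‖ ≤ (j : ℝ) ^ j * R}
  have hB : {w : Fin j → EuclideanSpace ℝ (Fin n) | ∀ i, w i ∈ B}.Finite :=
    Set.Finite.pi' fun _ => finite_intSubgroup_ball _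
  refine (Set.Finite.image2
    (fun (m : ℤ) w => ((m : ℝ), (m : ℝ) * ((volPair u w).2 / (volPair u w).1)))
    (Set.finite_Icc 0 ⌈R⌉) hB).subset ?_
  rintro _ ⟨⟨v, hvΛ, hv, rfl⟩, hR⟩
  obtain ⟨m, hm⟩ := exists_int_det_gram hvΛ
  obtain ⟨w, hw, hwΛ, -, hspan, hprod⟩ :=
    exists_prod_norm_sq_le (Λ := intSubgroup n) finite_intSubgroup_ball hv hvΛ
  have hone : ∀ i, 1 ≤ ‖w i‖ := fun i => one_le_norm_of_mem_intLattice (hwΛ i) (hw.ne_zero i)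
  have hpos := volPair_fst_pos u hv
  have hwpos := volPair_fst_pos u hw
  obtain ⟨C, -, hC⟩ := exists_volPair_eq_smul u (v := v) (w := w) fun i => by
    rw [hspan]; exact Submodule.subset_span ⟨i, rfl⟩
  have hm' : (volPair u v).1 = m := hm
  refine ⟨m, ⟨?_, ?_⟩, w, fun i => ⟨hwΛ i, ?_⟩, ?_⟩
  · rw [hm'] at hpos
    exact_mod_cast hpos.le
  · rw [hm'] at hR
    exact_mod_cast hR.trans (Int.le_ceil R)
  · calc ‖w i‖ ≤ ‖w i‖ ^ 2 := le_self_pow₀ (hone i) two_ne_zero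
      _ ≤ ∏ l, ‖w l‖ ^ 2 := by
        rw [← Finset.mul_prod_erase _ _ (Finset.mem_univ i)]
        exact le_mul_of_one_le_right (by positivity)
          (Finset.one_le_prod fun l _ => one_le_pow₀ (hone l))
      _ ≤ _ := hprod.trans (by gcongr; exact hR)
  · ext
    · exact hm'.symm
    · simp only [← hm', hC, Prod.smul_fst, Prod.smul_snd, smul_eq_mul]
      field_simp

lemma isHingeFamily_volSet (u : EuclideanSpace ℝ (Fin n)) {j : ℕ} (hj : j ≤ n) :
    IsHingeFamily (volSet u j) where
  nonempty := by
    refine ⟨_, fun i => EuclideanSpace.basisFun (Fin n) ℝ (Fin.castLE hj i),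
      fun i => basisFun_mem_intLattice _, ?_, rfl⟩
    exact (EuclideanSpace.basisFun (Fin n) ℝ).orthonormal.linearIndependent.comp _
      (Fin.castLE_injective hj)
  fst_pos := by
    rintro _ ⟨v, -, hv, rfl⟩
    exact volPair_fst_pos u hv
  snd_nonneg := by
    rintro _ ⟨v, -, hv, rfl⟩
    exact volPair_snd_nonneg u hv
  finite := finite_volSet u j

lemma envelope_volSet_zero (u : EuclideanSpace ℝ (Fin n)) (q : ℝ) :
    envelope (volSet u 0) q = 0 := by
  obtain ⟨_, ⟨v, -, -, rfl⟩, h, -⟩ := (isHingeFamily_volSet u (Nat.zero_le n)).exists_eq q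
  rw [h]
  simp [volPair, hinge]

lemma envelope_volSet_top (u : EuclideanSpace ℝ (Fin n)) (hu : ‖u‖ = 1) {q : ℝ} (hq : 0 ≤ q) :
    envelope (volSet u n) q = q := by
  let e := EuclideanSpace.basisFun (Fin n) ℝ
  have he : LinearIndependent ℝ e := e.orthonormal.linearIndependent
  have hexp : 1 ≤ Real.exp (2 * q) := Real.one_le_exp (by linarith)
  have hg : Matrix.gram ℝ e = 1 := Matrix.gram_eq_one_iff_orthonormal.2 e.orthonormal
  have hpair : volPair u e = (1, 1) := by
    rw [volPair, det_gram_stretch_aux u 0 he, hg]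
    have : ∑ i, ⟪e i, u⟫ * ⟪e i, u⟫ = 1 := by
      have := e.sum_sq_norm_inner_right u
      rw [hu] at this
      simpa [← sq] using this
    simp [dotProduct, this]
  have hval : hinge (volPair u e) q = q := by
    rw [hpair, hinge_of_ge one_pos (by simpa using hexp)]
    simp
  have hmem : volPair u e ∈ volSet u n := ⟨e, basisFun_mem_intLattice, he, rfl⟩
  refine (envelope_eq hmem ?_).trans hval
  rintro _ ⟨v, hvΛ, hv, rfl⟩
  obtain ⟨C, -, hC⟩ := exists_volPair_eq_smul u (v := v) (w := e) fun i => by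
    rw [← e.coe_toBasis, e.toBasis.span_eq]; trivial
  obtain ⟨m, hm⟩ := exists_int_det_gram hvΛ
  have hpos := volPair_fst_pos u hv
  have hm' : (volPair u v).1 = m := hm
  have hm1 : (1 : ℝ) ≤ m := by
    rw [hm'] at hpos
    exact_mod_cast hpos
  have h12 : (volPair u v).2 = (volPair u v).1 := by rw [hC, hpair]; simp
  rw [hval, hinge_of_ge hpos (by rw [h12]; exact le_mul_of_one_le_left hpos.le hexp), h12, hm']
  have := Real.log_nonneg hm1
  linarith

end Lattice

section Estimates

variable {n : ℕ}

/-- The image of the integer lattice under `stretch u q`. -/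
def stretchLattice (u : EuclideanSpace ℝ (Fin n)) (q : ℝ) :
    AddSubgroup (WithLp 2 (EuclideanSpace ℝ (Fin n) × ℝ)) :=
  (intSubgroup n).map (stretch u q).toAddMonoidHom

variable {u : EuclideanSpace ℝ (Fin n)} {q : ℝ}

lemma stretch_mem_stretchLattice {y : EuclideanSpace ℝ (Fin n)} (hy : y ∈ intLattice n) :
    stretch u q y ∈ stretchLattice u q :=
  AddSubgroup.mem_map_of_mem _ (show y ∈ intSubgroup n from hy)

lemma exists_of_mem_stretchLattice {x : WithLp 2 (EuclideanSpace ℝ (Fin n) × ℝ)}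
    (hx : x ∈ stretchLattice u q) : ∃ y ∈ intLattice n, stretch u q y = x := hx

lemma finite_stretchLattice_ball (R : ℝ) :
    {y ∈ (stretchLattice u q : Set (WithLp 2 (EuclideanSpace ℝ (Fin n) × ℝ))) | ‖y‖ ≤ R}.Finite := by
  refine ((finite_intSubgroup_ball (n := n) R).image (stretch u q)).subset ?_
  rintro _ ⟨hx, hR⟩
  obtain ⟨y, hy, rfl⟩ := exists_of_mem_stretchLattice hx
  exact ⟨y, ⟨hy, (norm_le_norm_stretch u q y).trans hR⟩, rfl⟩

lemma exists_minimaSystem_stretchLattice (u : EuclideanSpace ℝ (Fin n)) (q : ℝ) :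
    ∃ x : Fin n → WithLp 2 (EuclideanSpace ℝ (Fin n) × ℝ),
      IsMinimaSystem (stretchLattice u q : Set _) x := by
  refine exists_isMinimaSystem finite_stretchLattice_ball n ?_
  let e := EuclideanSpace.basisFun (Fin n) ℝ
  have he : LinearIndependent ℝ (stretch u q ∘ e) :=
    linearIndependent_stretch u q e.orthonormal.linearIndependent
  have h1 := finrank_span_eq_card he
  rw [Fintype.card_fin] at h1
  refine h1.ge.trans (Submodule.finrank_mono (Submodule.span_mono ?_))
  rintro _ ⟨i, rfl⟩
  exact stretch_mem_stretchLattice (basisFun_mem_intLattice i)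

variable {x : Fin n → WithLp 2 (EuclideanSpace ℝ (Fin n) × ℝ)}

lemma one_le_norm_minima (hx : IsMinimaSystem (stretchLattice u q : Set _) x) (i : Fin n) :
    1 ≤ ‖x i‖ := by
  obtain ⟨y, hy, hyx⟩ := exists_of_mem_stretchLattice (hx.mem i)
  have hy0 : y ≠ 0 := by
    rintro rfl
    exact hx.linInd.ne_zero i (by rw [← hyx, map_zero])
  rw [← hyx]
  exact (one_le_norm_of_mem_intLattice hy hy0).trans (norm_le_norm_stretch u q y)

lemma norm_minima_le {j : ℕ} (hx : IsMinimaSystem (stretchLattice u q : Set _) x) (hj : j ≤ n)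
    {y : Fin j → WithLp 2 (EuclideanSpace ℝ (Fin n) × ℝ)} (hy : LinearIndependent ℝ y)
    (hyΛ : ∀ i, y i ∈ stretchLattice u q) (hmono : Monotone fun i => ‖y i‖) (i : Fin j) :
    ‖x (Fin.castLE hj i)‖ ≤ ‖y i‖ := by
  have hi : (i : ℕ) + 1 ≤ j := i.2
  have hli : LinearIndependent ℝ (y ∘ Fin.castLE hi) := hy.comp _ (Fin.castLE_injective hi)
  refine hx.le_of_lt_finrank _ (Y := Set.range (y ∘ Fin.castLE hi)) ?_ ?_ ?_
  · rintro _ ⟨l, rfl⟩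
    exact hyΛ _
  · rintro _ ⟨l, rfl⟩
    exact hmono (Fin.le_def.2 (Nat.lt_succ_iff.1 l.2))
  · rw [finrank_span_eq_card hli]
    simp

/-- Every integral tuple is comparable with a tuple of lattice vectors with the same span whose
norms have product at most a constant times the volume. -/
lemma exists_sum_log_le {j : ℕ} {v : Fin j → EuclideanSpace ℝ (Fin n)}
    (hvΛ : ∀ i, v i ∈ intLattice n) (hv : LinearIndependent ℝ v) :
    ∃ y : Fin j → WithLp 2 (EuclideanSpace ℝ (Fin n) × ℝ), LinearIndependent ℝ y ∧
      (∀ i, y i ∈ stretchLattice u q) ∧ Monotone (fun i => ‖y i‖) ∧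
      Submodule.span ℝ (Set.range y) = Submodule.span ℝ (Set.range (stretch u q ∘ v)) ∧
      ∑ i, Real.log ‖y i‖ ≤ hinge (volPair u v) q + (Real.log 2 + j * Real.log j) / 2 := by
  have hv' := linearIndependent_stretch u q hv
  obtain ⟨y, hy, hyΛ, hmono, hspan, hprod⟩ := exists_prod_norm_sq_le (Λ := stretchLattice u q)
    finite_stretchLattice_ball hv' fun i => stretch_mem_stretchLattice (hvΛ i)
  refine ⟨y, hy, hyΛ, hmono, hspan, ?_⟩
  have hpos : ∀ i, 0 < ‖y i‖ := fun i => norm_pos_iff.2 (hy.ne_zero i)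
  have h1 : Real.log (∏ i, ‖y i‖ ^ 2) = 2 * ∑ i, Real.log ‖y i‖ := by
    rw [Real.log_prod fun i _ => (pow_pos (hpos i) 2).ne', Finset.mul_sum]
    refine Finset.sum_congr rfl fun i _ => ?_
    rw [Real.log_pow]
    norm_num
  have hjj : (0 : ℝ) < (j : ℝ) ^ j := by
    rcases Nat.eq_zero_or_pos j with rfl | hj
    · simp
    · positivity
  have h2 := Real.log_le_log (Finset.prod_pos fun i _ => pow_pos (hpos i) 2) hprod
  rw [h1, Real.log_mul hjj.ne' (det_gram_pos hv').ne', Real.log_pow] at h2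
  have h3 := log_det_gram_stretch_le u q hv
  linarith

lemma envelope_le_sum_log {j : ℕ} (hx : IsMinimaSystem (stretchLattice u q : Set _) x)
    (hj : j ≤ n) :
    envelope (volSet u j) q ≤ ∑ i : Fin j, Real.log ‖x (Fin.castLE hj i)‖ := by
  choose v hvΛ hvx using fun i => exists_of_mem_stretchLattice (hx.mem i)
  have hcomp : stretch u q ∘ (v ∘ Fin.castLE hj) = x ∘ Fin.castLE hj := by
    ext1 i
    simp [hvx]
  have hxl : LinearIndependent ℝ (x ∘ Fin.castLE hj) :=
    hx.linInd.comp _ (Fin.castLE_injective hj)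
  have hvl : LinearIndependent ℝ (v ∘ Fin.castLE hj) :=
    LinearIndependent.of_comp (stretch u q) (hcomp ▸ hxl)
  refine ((isHingeFamily_volSet u hj).envelope_le ⟨_, fun i => hvΛ _, hvl, rfl⟩ q).trans
    ((hinge_volPair_le u q hvl).trans ?_)
  rw [hcomp]
  have hpos : ∀ i, 0 < ‖(x ∘ Fin.castLE hj) i‖ := fun i => norm_pos_iff.2 (hxl.ne_zero i)
  have h1 := Real.log_le_log (det_gram_pos hxl) (det_gram_le_prod_norm_sq hxl)
  rw [Real.log_prod fun i _ => (pow_pos (hpos i) 2).ne'] at h1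
  simp only [Real.log_pow, ← Finset.mul_sum, Function.comp_apply] at h1
  push_cast at h1
  linarith

lemma sum_log_le_envelope {j : ℕ} (hx : IsMinimaSystem (stretchLattice u q : Set _) x)
    (hj : j ≤ n) :
    ∑ i : Fin j, Real.log ‖x (Fin.castLE hj i)‖ ≤
      envelope (volSet u j) q + (Real.log 2 + j * Real.log j) / 2 := by
  obtain ⟨_, ⟨v, hvΛ, hv, rfl⟩, h, -⟩ := (isHingeFamily_volSet u hj).exists_eq q
  obtain ⟨y, hy, hyΛ, hmono, -, hsum⟩ := exists_sum_log_le (u := u) (q := q) hvΛ hv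
  rw [h]
  refine le_trans (Finset.sum_le_sum fun i _ => ?_) hsum
  exact Real.log_le_log (zero_lt_one.trans_le (one_le_norm_minima hx _))
    (norm_minima_le hx hj hy hyΛ hmono i)

/-- If `y` has nearly minimal volume and its longest vector dominates the next minimum, then two
consecutive minima are close. -/
lemma log_minima_succ_le {m : ℕ} (hx : IsMinimaSystem (stretchLattice u q : Set _) x)
    (hm : m + 1 < n) {y : Fin (m + 1) → WithLp 2 (EuclideanSpace ℝ (Fin n) × ℝ)}
    (hy : LinearIndependent ℝ y) (hyΛ : ∀ i, y i ∈ stretchLattice u q)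
    (hmono : Monotone fun i => ‖y i‖) {K : ℝ}
    (hsum : ∑ i, Real.log ‖y i‖ ≤ envelope (volSet u (m + 1)) q + K)
    (hlast : ‖x ⟨m + 1, hm⟩‖ ≤ ‖y (Fin.last m)‖) :
    Real.log ‖x ⟨m + 1, hm⟩‖ ≤ Real.log ‖x ⟨m, by omega⟩‖ + K := by
  have h1 := envelope_le_sum_log hx hm.le
  rw [Fin.sum_univ_castSucc] at h1 hsum
  have hpos : ∀ i, 0 < ‖x i‖ := fun i => zero_lt_one.trans_le (one_le_norm_minima hx i)
  have h2 : ∑ i : Fin m, Real.log ‖x (Fin.castLE hm.le i.castSucc)‖ ≤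
      ∑ i : Fin m, Real.log ‖y i.castSucc‖ := Finset.sum_le_sum fun i _ =>
    Real.log_le_log (hpos _) (norm_minima_le hx hm.le hy hyΛ hmono _)
  have h3 := Real.log_le_log (hpos _) hlast
  have h4 : Fin.castLE hm.le (Fin.last m) = ⟨m, by omega⟩ := rfl
  rw [h4] at h1
  linarith

lemma log_minima_succ_le_of_changesSlopeOn {m : ℕ}
    (hx : IsMinimaSystem (stretchLattice u q : Set _) x) (hm : m + 1 < n) {q₀ : ℝ} (hq : q₀ < q)
    (h : ChangesSlopeOn (envelope (volSet u (m + 1))) q₀ q) :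
    Real.log ‖x ⟨m + 1, hm⟩‖ ≤ Real.log ‖x ⟨m, by omega⟩‖ +
      (Real.log 2 + (m + 1 : ℕ) * Real.log (m + 1 : ℕ)) / 2 := by
  obtain ⟨_, ⟨v, hvΛ, hv, rfl⟩, _, ⟨v', hvΛ', hv', rfl⟩, he, he', hlt, hlt'⟩ :=
    (isHingeFamily_volSet u hm.le).exists_of_changesSlopeOn hq h
  obtain ⟨y, hy, hyΛ, hmono, hspan, hsum⟩ := exists_sum_log_le (u := u) (q := q) hvΛ hv
  obtain ⟨y', hy', hyΛ', hmono', hspan', hsum'⟩ := exists_sum_log_le (u := u) (q := q) hvΛ' hv'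
  rw [← he] at hsum
  rw [← he'] at hsum'
  have hne : ¬ Submodule.span ℝ (Set.range y') ≤ Submodule.span ℝ (Set.range y) := by
    intro hle
    rw [hspan, hspan', Set.range_comp, Set.range_comp, ← Submodule.map_span, ← Submodule.map_span,
      Submodule.map_le_map_iff_of_injective (stretch_injective u q)] at hle
    obtain ⟨C, -, hC⟩ := exists_volPair_eq_smul u (v := v') (w := v) fun i =>
      hle (Submodule.subset_span ⟨i, rfl⟩)
    rw [hC] at hlt'
    simp only [Prod.smul_fst, Prod.smul_snd, smul_eq_mul] at hlt'
    nlinarith [mul_le_mul_of_nonneg_left hlt.le (sq_nonneg C.det)]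
  have hfr : m + 1 < Module.finrank ℝ (Submodule.span ℝ (Set.range y ∪ Set.range y')) := by
    have h1 : Submodule.span ℝ (Set.range y) < Submodule.span ℝ (Set.range y ∪ Set.range y') := by
      rw [Submodule.span_union]
      exact left_lt_sup.2 hne
    have h2 := Submodule.finrank_lt_finrank_of_lt h1
    rwa [finrank_span_eq_card hy, Fintype.card_fin] at h2
  have hR : ‖x ⟨m + 1, hm⟩‖ ≤ max ‖y (Fin.last m)‖ ‖y' (Fin.last m)‖ := by
    refine hx.le_of_lt_finrank _ (Y := Set.range y ∪ Set.range y') ?_ ?_ hfr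
    · rintro _ (⟨i, rfl⟩ | ⟨i, rfl⟩)
      exacts [hyΛ i, hyΛ' i]
    · rintro _ (⟨i, rfl⟩ | ⟨i, rfl⟩)
      exacts [le_max_of_le_left (hmono (Fin.le_last i)), le_max_of_le_right (hmono' (Fin.le_last i))]
  rcases le_max_iff.1 hR with hR | hR
  · exact log_minima_succ_le hx hm hy hyΛ hmono hsum hR
  · exact log_minima_succ_le hx hm hy' hyΛ' hmono' hsum' hR

lemma mem_smul_bodyC_iff {r : ℝ} (hr : 0 < r) {y : EuclideanSpace ℝ (Fin n)} :
    y ∈ r • bodyC u (Real.exp q) ↔ ‖y‖ ≤ r ∧ Real.exp q * |⟪y, u⟫| ≤ r := by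
  rw [Set.mem_smul_set_iff_inv_smul_mem₀ hr.ne', bodyC, Set.mem_ofPred_eq, norm_smul,
    inner_smul_left, abs_mul, norm_inv, Real.norm_of_nonneg hr.le]
  have h1 : |(starRingEnd ℝ) r⁻¹| = r⁻¹ := by
    rw [RCLike.conj_to_real, abs_of_pos (inv_pos.2 hr)]
  rw [h1, inv_mul_le_iff₀ hr, inv_mul_le_iff₀ hr, mul_one, ← div_eq_mul_inv,
    le_div_iff₀ (Real.exp_pos q), mul_comm |⟪y, u⟫|]

/-- The radii whose infimum is the `j`-th successive minimum of `bodyC u (exp q)`. -/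
def minkRadii (u : EuclideanSpace ℝ (Fin n)) (q : ℝ) (j : ℕ) : Set ℝ :=
  {r : ℝ | 0 < r ∧ ∃ t : Finset (EuclideanSpace ℝ (Fin n)),
    ↑t ⊆ intLattice n ∩ (r • bodyC u (Real.exp q)) ∧ j ≤ t.card ∧
    LinearIndependent ℝ (fun v : t => (v : EuclideanSpace ℝ (Fin n)))}

lemma bddBelow_minkRadii (u : EuclideanSpace ℝ (Fin n)) (q : ℝ) (j : ℕ) :
    BddBelow (minkRadii u q j) := ⟨0, fun _ hr => hr.1.le⟩

lemma norm_minima_mem_minkRadii (hx : IsMinimaSystem (stretchLattice u q : Set _) x) (i : Fin n) :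
    ‖x i‖ ∈ minkRadii u q (i + 1) := by
  classical
  have hpos : 0 < ‖x i‖ := zero_lt_one.trans_le (one_le_norm_minima hx i)
  choose v hvΛ hvx using fun i => exists_of_mem_stretchLattice (hx.mem i)
  have hcomp : stretch u q ∘ v = x := funext hvx
  have hvl : LinearIndependent ℝ v := LinearIndependent.of_comp (stretch u q) (hcomp ▸ hx.linInd)
  refine ⟨hpos, (Finset.Iic i).image v, ?_, ?_, ?_⟩
  · intro y hy
    obtain ⟨l, hl, rfl⟩ := Finset.mem_image.1 (Finset.mem_coe.1 hy)
    have hle : ‖stretch u q (v l)‖ ≤ ‖x i‖ := by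
      rw [hvx]
      exact hx.monotone (Finset.mem_Iic.1 hl)
    exact ⟨hvΛ l, (mem_smul_bodyC_iff hpos).2 ⟨(norm_le_norm_stretch u q _).trans hle,
      (exp_mul_abs_inner_le_norm_stretch u q _).trans hle⟩⟩
  · rw [Finset.card_image_of_injective _ hvl.injective]
    simp
  · refine LinearIndepOn.mono hvl.linearIndepOn_id fun y hy => ?_
    obtain ⟨l, -, rfl⟩ := Finset.mem_image.1 hy
    exact ⟨l, rfl⟩

lemma norm_minima_le_two_mul (hx : IsMinimaSystem (stretchLattice u q : Set _) x) (i : Fin n)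
    {r : ℝ} (hr : r ∈ minkRadii u q (i + 1)) : ‖x i‖ ≤ 2 * r := by
  obtain ⟨hr0, t, ht, hcard, hli⟩ := hr
  have hli' : LinearIndependent ℝ fun v : t => stretch u q v :=
    hli.map' _ (LinearMap.ker_eq_bot.2 (stretch_injective u q))
  refine hx.le_of_lt_finrank i (Y := Set.range fun v : t => stretch u q v) ?_ ?_ ?_
  · rintro _ ⟨v, rfl⟩
    exact stretch_mem_stretchLattice (ht v.2).1
  · rintro _ ⟨v, rfl⟩
    obtain ⟨h1, h2⟩ := (mem_smul_bodyC_iff hr0).1 (ht v.2).2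
    refine le_of_sq_le_sq ?_ (by positivity)
    rw [norm_stretch_sq]
    have h3 := pow_le_pow_left₀ (norm_nonneg _) h1 2
    have h4 := pow_le_pow_left₀ (by positivity) h2 2
    nlinarith
  · rw [finrank_span_eq_card hli', Fintype.card_coe]
    omega

lemma minkMin_le_norm_minima (hx : IsMinimaSystem (stretchLattice u q : Set _) x) (i : Fin n) :
    minkMin (intLattice n) (bodyC u (Real.exp q)) (i + 1) ≤ ‖x i‖ :=
  csInf_le (bddBelow_minkRadii u q _) (norm_minima_mem_minkRadii hx i)

lemma norm_minima_le_two_mul_minkMin (hx : IsMinimaSystem (stretchLattice u q : Set _) x)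
    (i : Fin n) : ‖x i‖ ≤ 2 * minkMin (intLattice n) (bodyC u (Real.exp q)) (i + 1) := by
  have : ‖x i‖ / 2 ≤ minkMin (intLattice n) (bodyC u (Real.exp q)) (i + 1) :=
    le_csInf ⟨_, norm_minima_mem_minkRadii hx i⟩ fun r hr => by
      linarith [norm_minima_le_two_mul hx i hr]
  linarith

lemma minkMin_pos (u : EuclideanSpace ℝ (Fin n)) (q : ℝ) (i : Fin n) :
    0 < minkMin (intLattice n) (bodyC u (Real.exp q)) (i + 1) := by
  obtain ⟨x, hx⟩ := exists_minimaSystem_stretchLattice u q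
  linarith [one_le_norm_minima hx i, norm_minima_le_two_mul_minkMin hx i]

lemma minkMin_mono (u : EuclideanSpace ℝ (Fin n)) {q₁ q₂ : ℝ} (h : q₁ ≤ q₂) (i : Fin n) :
    minkMin (intLattice n) (bodyC u (Real.exp q₁)) (i + 1) ≤
      minkMin (intLattice n) (bodyC u (Real.exp q₂)) (i + 1) := by
  obtain ⟨x, hx⟩ := exists_minimaSystem_stretchLattice u q₂
  refine csInf_le_csInf (bddBelow_minkRadii u q₁ _) ⟨_, norm_minima_mem_minkRadii hx i⟩ ?_
  rintro r ⟨hr, t, ht, hcard, hli⟩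
  refine ⟨hr, t, fun y hy => ⟨(ht hy).1, ?_⟩, hcard, hli⟩
  obtain ⟨h1, h2⟩ := (mem_smul_bodyC_iff hr).1 (ht hy).2
  exact (mem_smul_bodyC_iff hr).2 ⟨h1, le_trans (by gcongr) h2⟩

end Estimates

section Main

variable {n : ℕ}

lemma sum_filter_lt_eq_sum_range {j : ℕ} (hj : j ≤ n) (F : ℕ → ℝ) :
    ∑ i ∈ Finset.univ.filter (fun i : Fin n => (i : ℕ) < j), F i = ∑ i ∈ Finset.range j, F i := by
  rw [Finset.sum_filter, Fin.sum_univ_eq_sum_range (fun i => if i < j then F i else 0) n,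
    ← Finset.sum_filter]
  refine Finset.sum_congr ?_ fun _ _ => rfl
  ext i
  simp only [Finset.mem_filter, Finset.mem_range]
  omega

/-- The increments of the envelopes of the volume functions. -/
def volSystem (u : EuclideanSpace ℝ (Fin n)) (q : ℝ) (i : Fin n) : ℝ :=
  envelope (volSet u (i + 1)) q - envelope (volSet u i) q

lemma Msum_volSystem (u : EuclideanSpace ℝ (Fin n)) {j : ℕ} (hj : j ≤ n) :
    Msum (volSystem u) j = envelope (volSet u j) := by
  ext q
  unfold Msum volSystem
  rw [sum_filter_lt_eq_sum_range hj
    fun i => envelope (volSet u (i + 1)) q - envelope (volSet u i) q,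
    Finset.sum_range_sub (fun i => envelope (volSet u i) q), envelope_volSet_zero, sub_zero]

lemma const_le {j : ℕ} (hj : j ≤ n) (hn : 2 ≤ n) :
    (Real.log 2 + j * Real.log j) / 2 ≤ n * Real.log n := by
  have hn' : (2 : ℝ) ≤ n := by exact_mod_cast hn
  have h2 : Real.log 2 ≤ Real.log n := Real.log_le_log (by norm_num) hn'
  have h0 : 0 < Real.log 2 := Real.log_pos (by norm_num)
  have hjn : (j : ℝ) * Real.log j ≤ n * Real.log n := by
    rcases Nat.eq_zero_or_pos j with rfl | hj0
    · simp only [CharP.cast_eq_zero, zero_mul]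
      nlinarith
    · have h3 : (1 : ℝ) ≤ j := by exact_mod_cast hj0
      have h4 : (j : ℝ) ≤ n := by exact_mod_cast hj
      have h5 : Real.log j ≤ Real.log n := Real.log_le_log (by linarith) h4
      have h6 := Real.log_nonneg h3
      gcongr
  nlinarith

lemma abs_volSystem_sub_log_minima_le (hn : 2 ≤ n) {u : EuclideanSpace ℝ (Fin n)} {q : ℝ}
    {x : Fin n → WithLp 2 (EuclideanSpace ℝ (Fin n) × ℝ)}
    (hx : IsMinimaSystem (stretchLattice u q : Set _) x) (i : Fin n) :
    |volSystem u q i - Real.log ‖x i‖| ≤ n * Real.log n := by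
  have hi : (i : ℕ) + 1 ≤ n := i.2
  have h1 := envelope_le_sum_log hx hi
  have h2 := sum_log_le_envelope hx hi
  have h3 := envelope_le_sum_log hx i.2.le
  have h4 := sum_log_le_envelope hx i.2.le
  have h5 := const_le hi hn
  have h6 := const_le i.2.le hn
  rw [Fin.sum_univ_castSucc] at h1 h2
  have h7 : Fin.castLE hi (Fin.last i) = i := rfl
  have h8 : ∑ l : Fin i, Real.log ‖x (Fin.castLE hi l.castSucc)‖ =
    ∑ l : Fin i, Real.log ‖x (Fin.castLE i.2.le l)‖ := rfl
  rw [h7, h8] at h1 h2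
  rw [volSystem, abs_le]
  constructor <;> linarith

lemma abs_volSystem_sub_log_minkMin_le (hn : 2 ≤ n) (u : EuclideanSpace ℝ (Fin n)) (q : ℝ)
    (i : Fin n) :
    |volSystem u q i - Real.log (minkMin (intLattice n) (bodyC u (Real.exp q)) (i + 1))| ≤
      2 * (n * Real.log n) := by
  obtain ⟨x, hx⟩ := exists_minimaSystem_stretchLattice u q
  have h1 := abs_le.1 (abs_volSystem_sub_log_minima_le hn hx i)
  have hpos := minkMin_pos u q i
  have h2 := Real.log_le_log hpos (minkMin_le_norm_minima hx i)
  have h3 := Real.log_le_log (zero_lt_one.trans_le (one_le_norm_minima hx i))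
    (norm_minima_le_two_mul_minkMin hx i)
  rw [Real.log_mul two_ne_zero hpos.ne'] at h3
  have hn' : (2 : ℝ) ≤ n := by exact_mod_cast hn
  have h4 : Real.log 2 ≤ Real.log n := Real.log_le_log (by norm_num) hn'
  have h5 : 0 < Real.log 2 := Real.log_pos (by norm_num)
  rw [abs_le]
  constructor <;> nlinarith

lemma isNSystem_volSystem (hn : 2 ≤ n) {u : EuclideanSpace ℝ (Fin n)} (hu : ‖u‖ = 1) {γ : ℝ}
    (hγ : 4 * (n * Real.log n) ≤ γ) : IsNSystem n γ 0 (volSystem u) := by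
  have hK : 0 ≤ n * Real.log n :=
    mul_nonneg (Nat.cast_nonneg n) (Real.log_natCast_nonneg n)
  refine ⟨fun q _ j => ?_, fun q _ j h => ?_, fun j q₁ q₂ _ h => ?_, fun j hj => ?_,
    fun q hq => ?_, fun j hj1 hj q hq h => ?_⟩
  · obtain ⟨x, hx⟩ := exists_minimaSystem_stretchLattice u q
    have h1 := abs_le.1 (abs_volSystem_sub_log_minima_le hn hx j)
    have h2 := Real.log_nonneg (one_le_norm_minima hx j)
    linarith
  · obtain ⟨x, hx⟩ := exists_minimaSystem_stretchLattice u q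
    have h1 := abs_le.1 (abs_volSystem_sub_log_minima_le hn hx j)
    have h2 := abs_le.1 (abs_volSystem_sub_log_minima_le hn hx ⟨j + 1, h⟩)
    have h3 := Real.log_le_log (zero_lt_one.trans_le (one_le_norm_minima hx j))
      (hx.monotone (show j ≤ ⟨j + 1, h⟩ from Fin.le_def.2 (Nat.le_succ _)))
    linarith
  · have h1 := abs_le.1 (abs_volSystem_sub_log_minkMin_le hn u q₁ j)
    have h2 := abs_le.1 (abs_volSystem_sub_log_minkMin_le hn u q₂ j)
    have h3 := Real.log_le_log (minkMin_pos u q₁ j) (minkMin_mono u h j)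
    linarith
  · rw [Msum_volSystem u hj]
    exact ⟨(isHingeFamily_volSet u hj).continuous.continuousOn,
      (isHingeFamily_volSet u hj).slope01On 0⟩
  · rw [Msum_volSystem u le_rfl, envelope_volSet_top u hu hq]
  · obtain ⟨m, rfl⟩ : ∃ m, j = m + 1 := ⟨j - 1, by omega⟩
    rw [Msum_volSystem u hj.le] at h
    obtain ⟨x, hx⟩ := exists_minimaSystem_stretchLattice u q
    have h1 := log_minima_succ_le_of_changesSlopeOn hx hj hq h
    have h2 := abs_le.1 (abs_volSystem_sub_log_minima_le hn hx ⟨m + 1, hj⟩)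
    have h3 := abs_le.1 (abs_volSystem_sub_log_minima_le hn hx ⟨m, by omega⟩)
    have h4 := const_le hj.le hn
    simp only [Nat.add_sub_cancel]
    linarith

end Main

/-- Schmidt–Summerer approximation theorem.  Let
`γ = 6 n 2ⁿ log n`.  For each unit vector `u` of `ℝⁿ` there is an
`(n,γ)`-system `P` on `[0,∞)` with `sup_{q ≥ 0} ‖P(q) − L_u(q)‖_∞ ≤ γ`, where
`L_u(q) = (log λ₁(C_u(e^q)), …, log λ_n(C_u(e^q)))`. -/
theorem stmt16 (n : ℕ) (hn : 2 ≤ n) (γ : ℝ)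
    (hγ : γ = 6 * n * 2 ^ n * Real.log n)
    (u : EuclideanSpace ℝ (Fin n)) (hu : ‖u‖ = 1) :
    ∃ P : ℝ → Fin n → ℝ, IsNSystem n γ 0 P ∧
      ∀ q : ℝ, 0 ≤ q → ∀ j : Fin n,
        |P q j - Real.log (minkMin (intLattice n) (bodyC u (Real.exp q)) ((j : ℕ) + 1))|
          ≤ γ := by
  have hK : 0 ≤ n * Real.log n :=
    mul_nonneg (Nat.cast_nonneg n) (Real.log_natCast_nonneg n)
  have hle : 4 * (n * Real.log n) ≤ γ := by
    have h2 : (1 : ℝ) ≤ 2 ^ n := one_le_pow₀ (by norm_num)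
    have : γ = 6 * (n * Real.log n) * 2 ^ n := by rw [hγ]; ring
    rw [this]
    nlinarith
  refine ⟨volSystem u, isNSystem_volSystem hn hu hle, fun q _ j => ?_⟩
  exact (abs_volSystem_sub_log_minkMin_le hn u q j).trans (by linarith)
end
end

section
/- Let γ ≥ 0 and let P: [0,∞) → ℝ^n be an (n,γ)-system. Then there exists an (n,2nγ)-reduced system P̃: [0,∞) → ℝ^n with ‖P(q) − P̃(q)‖_∞ ≤ nγ for all q ≥ 0. -/
open scoped RealInnerProductSpace
open Finset

noncomputable section

/-- An `(n,γ)`-reduced system on `[q₀,∞)`: an `(n,γ)`-system such that whenever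
`P_1+⋯+P_j` (`1 ≤ j ≤ n−1`) is constant on `[a,b]` with `b ≥ a + nγ`, the
functions `P_1,…,P_j` are all constant on `[a, b − nγ]`. -/
def IsReducedSystem (n : ℕ) (γ q₀ : ℝ) (P : ℝ → Fin n → ℝ) : Prop :=
  IsNSystem n γ q₀ P ∧
  ∀ j : ℕ, 1 ≤ j → j < n → ∀ a b : ℝ, q₀ ≤ a → a + n * γ ≤ b →
    (∀ q ∈ Set.Icc a b, Msum P j q = Msum P j a) →
    ∀ i : Fin n, (i : ℕ) < j → ∀ q ∈ Set.Icc a (b - n * γ), P q i = P a i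

open Filter Topology

/-- `f` is nondecreasing and `1`-Lipschitz on `[0,∞)`. -/
def SlowGrowth (f : ℝ → ℝ) : Prop :=
  ∀ ⦃x y : ℝ⦄, 0 ≤ x → x ≤ y → f x ≤ f y ∧ f y ≤ f x + (y - x)

lemma Slope01On.slowGrowth {f : ℝ → ℝ} (hf : Slope01On f 0) (hc : ContinuousOn f (Set.Ici 0)) :
    SlowGrowth f := by
  intro x y hx hxy
  have hcx : ContinuousOn f (Set.Icc x y) := hc.mono fun z hz => hx.trans hz.1
  have hd : ∀ z ∈ Set.Ico x y, ∃ d, HasDerivWithinAt f d (Set.Ici z) z ∧ 0 ≤ d ∧ d ≤ 1 := by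
    intro z hz
    rcases hf.1 z (hx.trans hz.1) with h | h
    · exact ⟨0, h, le_rfl, zero_le_one⟩
    · exact ⟨1, h, zero_le_one, le_rfl⟩
  choose! d hd h0 h1 using hd
  constructor
  · have := image_le_of_deriv_right_le_deriv_boundary (f := fun z => -f z) (f' := fun z => -d z)
      (B := fun _ => -f x) (B' := fun _ => 0) hcx.neg (fun z hz => (hd z hz).neg) le_rfl
      continuousOn_const (fun z _ => hasDerivWithinAt_const _ _ _)
      (fun z hz => neg_nonpos.2 (h0 z hz)) (Set.right_mem_Icc.2 hxy)
    exact neg_le_neg_iff.1 this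
  · have := image_le_of_deriv_right_le_deriv_boundary (f := f) (f' := d)
      (B := fun z => f x + (z - x)) (B' := fun _ => 1) hcx hd (by simp)
      (by fun_prop) (fun z _ => (((hasDerivAt_id z).sub_const x).const_add (f x)).hasDerivWithinAt)
      h1 (Set.right_mem_Icc.2 hxy)
    exact this

lemma SlowGrowth.continuousOn {f : ℝ → ℝ} (hf : SlowGrowth f) : ContinuousOn f (Set.Ici 0) := by
  refine (LipschitzOnWith.of_dist_le_mul (K := 1) fun x hx y hy => ?_).continuousOn
  rw [Real.dist_eq, Real.dist_eq, NNReal.coe_one, one_mul]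
  rcases le_total x y with h | h
  · have := hf hx h
    rw [abs_sub_comm, abs_of_nonneg (by linarith), abs_sub_comm, abs_of_nonneg (by linarith)]
    linarith
  · have := hf hy h
    rw [abs_of_nonneg (by linarith), abs_of_nonneg (by linarith)]
    linarith

lemma SlowGrowth.eq_of_mem_Icc {F : ℝ → ℝ} (hF : SlowGrowth F) {a b z : ℝ} (ha : 0 ≤ a)
    (h : F a = F b) (hz : z ∈ Set.Icc a b) : F z = F a :=
  le_antisymm (h ▸ (hF (ha.trans hz.1) hz.2).1) (hF ha hz.1).1

lemma Slope01On.continuousOn {f : ℝ → ℝ} (hf : Slope01On f 0) : ContinuousOn f (Set.Ici 0) := by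
  intro q hq
  have hr : ContinuousWithinAt f (Set.Ici q) q := by
    rcases hf.1 q hq with h | h <;> exact h.continuousWithinAt
  rcases (Set.mem_Ici.1 hq).eq_or_lt with h0 | h0
  · rwa [← h0] at hr ⊢
  · have hl : ContinuousWithinAt f (Set.Icc 0 q) q := by
      rcases hf.2 q h0 with h | h <;> exact h.continuousWithinAt
    refine (hl.union hr).mono fun z hz => ?_
    rcases le_total z q with h | h
    · exact Or.inl ⟨hz, h⟩
    · exact Or.inr h

lemma HasDerivWithinAt.congr_Icc_right {f g : ℝ → ℝ} {d q r : ℝ} (hqr : q < r)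
    (h : ∀ z ∈ Set.Icc q r, g z = f z) (hf : HasDerivWithinAt f d (Set.Ici q) q) :
    HasDerivWithinAt g d (Set.Ici q) q :=
  ((hf.mono Set.Icc_subset_Ici_self).congr h
    (h q (Set.left_mem_Icc.2 hqr.le))).mono_of_mem_nhdsWithin (Icc_mem_nhdsGE hqr)

lemma HasDerivWithinAt.congr_Icc_left {f g : ℝ → ℝ} {d q x : ℝ} (hx : 0 ≤ x) (hxq : x < q)
    (h : ∀ z ∈ Set.Icc x q, g z = f z) (hf : HasDerivWithinAt f d (Set.Icc 0 q) q) :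
    HasDerivWithinAt g d (Set.Icc 0 q) q :=
  ((hf.mono (Set.Icc_subset_Icc_left hx)).congr h
    (h q (Set.right_mem_Icc.2 hxq.le))).mono_of_mem_nhdsWithin
    (nhdsWithin_mono _ Set.Icc_subset_Iic_self (Icc_mem_nhdsLE hxq))

lemma HasDerivWithinAt.unique_Ici {f : ℝ → ℝ} {d e q : ℝ}
    (h : HasDerivWithinAt f d (Set.Ici q) q) (h' : HasDerivWithinAt f e (Set.Ici q) q) : d = e :=
  (uniqueDiffOn_Ici q q Set.self_mem_Ici).eq_deriv _ h h'

lemma HasDerivWithinAt.unique_Icc {f : ℝ → ℝ} {d e q : ℝ} (hq : 0 < q)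
    (h : HasDerivWithinAt f d (Set.Icc 0 q) q) (h' : HasDerivWithinAt f e (Set.Icc 0 q) q) :
    d = e :=
  (uniqueDiffOn_Icc hq q (Set.right_mem_Icc.2 hq.le)).eq_deriv _ h h'

/-- A Rolle-type criterion: if `f` beats the slope `θ` from `x` somewhere on `(x, y]`, and either
has lost this lead at `y` or is flat to the right of `y`, then it changes slope in `(x, y]`. -/
lemma Slope01On.exists_changesSlopeOn {f : ℝ → ℝ} (hf : Slope01On f 0) {x y z θ : ℝ} (hx : 0 ≤ x)
    (hθ0 : 0 < θ) (hθ1 : θ < 1) (hz : z ∈ Set.Icc x y) (hfz : θ * (z - x) < f z - f x)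
    (hy : f y - f x ≤ θ * (y - x) ∨ HasDerivWithinAt f 0 (Set.Ici y) y) :
    ∃ c ∈ Set.Ioc x y, ChangesSlopeOn f 0 c := by
  have hxy : x ≤ y := hz.1.trans hz.2
  have hc : ContinuousOn (fun s => f s - θ * s) (Set.Icc x y) :=
    (hf.continuousOn.mono fun z hz => hx.trans hz.1).sub (by fun_prop)
  obtain ⟨c, hcm, hmax⟩ := isCompact_Icc.exists_isMaxOn ⟨x, Set.left_mem_Icc.2 hxy⟩ hc
  have hmax' : ∀ s ∈ Set.Icc x y, f s - θ * s ≤ f c - θ * c := fun s hs => hmax hs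
  have hzc := hmax' z hz
  have hxc : x < c := by
    refine lt_of_le_of_ne hcm.1 ?_
    rintro rfl
    linarith
  refine ⟨c, ⟨hxc, hcm.2⟩, ?_, ?_⟩
  · rcases hf.2 c (hx.trans_lt hxc) with h | h
    · exfalso
      have h1 : HasDerivWithinAt (fun s => f s - θ * s) (0 - θ * 1) (Set.Iio c) c :=
        ((h.sub ((hasDerivWithinAt_id c _).const_mul θ)).mono_of_mem_nhdsWithin
          (mem_of_superset (Ico_mem_nhdsLT (hx.trans_lt hxc)) fun s hs => ⟨hs.1, hs.2.le⟩))
      have h2 := (hasDerivWithinAt_iff_tendsto_slope' (by simp)).1 h1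
      have h3 : ∀ᶠ s in 𝓝[<] c, 0 ≤ slope (fun s => f s - θ * s) c s := by
        filter_upwards [Ico_mem_nhdsLT hxc] with s hs
        rw [slope_def_field]
        exact div_nonneg_of_nonpos (sub_nonpos.2 (hmax' s ⟨hs.1, hs.2.le.trans hcm.2⟩))
          (sub_nonpos.2 hs.2.le)
      have := ge_of_tendsto h2 h3
      linarith
    · exact h
  · rcases hcm.2.eq_or_lt with rfl | hcy
    · rcases hy with h | h
      · linarith
      · exact h
    rcases hf.1 c (hx.trans hxc.le) with h | h
    · exact h
    · exfalso
      have h1 : HasDerivWithinAt (fun s => f s - θ * s) (1 - θ * 1) (Set.Ioi c) c :=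
        (h.sub ((hasDerivWithinAt_id c _).const_mul θ)).mono Set.Ioi_subset_Ici_self
      have h2 := (hasDerivWithinAt_iff_tendsto_slope' (by simp)).1 h1
      have h3 : ∀ᶠ s in 𝓝[>] c, slope (fun s => f s - θ * s) c s ≤ 0 := by
        filter_upwards [Ioc_mem_nhdsGT hcy] with s hs
        rw [slope_def_field]
        exact div_nonpos_of_nonpos_of_nonneg
          (sub_nonpos.2 (hmax' s ⟨hxc.le.trans hs.1.le, hs.2⟩)) (sub_nonneg.2 hs.1.le)
      have := le_of_tendsto h2 h3
      linarith

/-- The times at which `F` is about to stay constant for a duration of at least `L`. -/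
def stallSet (F : ℝ → ℝ) (L : ℝ) : Set ℝ := {t | 0 ≤ t ∧ F (t + L) = F t}

/-- The first time at which `F` takes its value at `t`. -/
def firstTime (F : ℝ → ℝ) (t : ℝ) : ℝ := sInf {s | 0 ≤ s ∧ F s = F t}

/-- The last element of `stallSet F L` up to `q`, or `0` if there is none. -/
def lastStall (F : ℝ → ℝ) (L q : ℝ) : ℝ := sSup {t | t ∈ insert 0 (stallSet F L) ∧ t ≤ q}

/-- The function `f`, frozen on the long intervals where `F` is constant, up to a duration `L` at
their end during which it catches up with slope `1`. -/
def lazify (f F : ℝ → ℝ) (L q : ℝ) : ℝ :=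
  min (f q) (f (firstTime F (lastStall F L q)) + (q - lastStall F L q))

section lazify

variable {f F : ℝ → ℝ} {L D : ℝ}

lemma firstTime_spec (hF : SlowGrowth F) {t : ℝ} (ht : 0 ≤ t) :
    0 ≤ firstTime F t ∧ firstTime F t ≤ t ∧ F (firstTime F t) = F t := by
  have hcl : IsClosed {s | 0 ≤ s ∧ F s = F t} :=
    hF.continuousOn.preimage_isClosed_of_isClosed isClosed_Ici (isClosed_singleton (x := F t))
  have hb : BddBelow {s | 0 ≤ s ∧ F s = F t} := ⟨0, fun s hs => hs.1⟩
  have hm := hcl.csInf_mem ⟨t, ht, rfl⟩ hb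
  exact ⟨hm.1, csInf_le hb ⟨ht, rfl⟩, hm.2⟩

lemma firstTime_le {s t : ℝ} (hs : 0 ≤ s) (h : F s = F t) : firstTime F t ≤ s :=
  csInf_le ⟨0, fun _ hs => hs.1⟩ ⟨hs, h⟩

lemma firstTime_congr {s t : ℝ} (h : F s = F t) : firstTime F s = firstTime F t := by
  rw [firstTime, firstTime, h]

lemma isClosed_stallSet (hF : SlowGrowth F) (hL : 0 < L) : IsClosed (stallSet F L) := by
  have hc : ContinuousOn (fun t => F (t + L) - F t) (Set.Ici 0) :=
    (hF.continuousOn.comp (by fun_prop) fun t ht => add_nonneg ht hL.le).sub hF.continuousOn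
  have := hc.preimage_isClosed_of_isClosed isClosed_Ici (isClosed_singleton (x := 0))
  convert this using 1
  ext t
  simp [stallSet, sub_eq_zero]

lemma exists_lastStall (hF : SlowGrowth F) (hL : 0 < L) {q : ℝ} (hq : 0 ≤ q) :
    ∃ t ∈ insert 0 (stallSet F L), 0 ≤ t ∧ t ≤ q ∧ ∀ z ∈ stallSet F L, z ≤ q → z ≤ t := by
  have hcl : IsClosed {t | t ∈ insert 0 (stallSet F L) ∧ t ≤ q} :=
    (isClosed_singleton.union (isClosed_stallSet hF hL)).inter isClosed_Iic
  have hb : BddAbove {t | t ∈ insert 0 (stallSet F L) ∧ t ≤ q} := ⟨q, fun s hs => hs.2⟩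
  have h0 : (0 : ℝ) ∈ {t | t ∈ insert 0 (stallSet F L) ∧ t ≤ q} := ⟨Set.mem_insert _ _, hq⟩
  have hm := hcl.csSup_mem ⟨0, h0⟩ hb
  exact ⟨_, hm.1, le_csSup hb h0, hm.2, fun z hz hzq =>
    le_csSup hb ⟨Set.mem_insert_of_mem _ hz, hzq⟩⟩

lemma lazify_eq_min {q t : ℝ} (ht : t ∈ insert 0 (stallSet F L)) (ht0 : 0 ≤ t) (htq : t ≤ q)
    (hmax : ∀ z ∈ stallSet F L, z ≤ q → z ≤ t) :
    lazify f F L q = min (f q) (f (firstTime F t) + (q - t)) := by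
  have : lastStall F L q = t := by
    refine IsGreatest.csSup_eq ⟨⟨ht, htq⟩, ?_⟩
    rintro z ⟨rfl | hz, hzq⟩
    · exact ht0
    · exact hmax z hz hzq
  rw [lazify, this]

lemma lazify_of_mem (hf : SlowGrowth f) (hF : SlowGrowth F) {q : ℝ} (hq : q ∈ stallSet F L) :
    lazify f F L q = f (firstTime F q) := by
  have hs := firstTime_spec hF hq.1
  rw [lazify_eq_min (Set.mem_insert_of_mem _ hq) hq.1 le_rfl fun _ _ h => h, sub_self, add_zero]
  exact min_eq_right (hf hs.1 hs.2.1).1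

lemma lazify_le (q : ℝ) : lazify f F L q ≤ f q := min_le_left _ _

lemma mem_stallSet_of_eq (hF : SlowGrowth F) (hL : 0 < L) {a b z : ℝ} (ha : 0 ≤ a)
    (h : F a = F b) (haz : a ≤ z) (hzb : z + L ≤ b) : z ∈ stallSet F L :=
  ⟨ha.trans haz, by
    rw [hF.eq_of_mem_Icc ha h ⟨by linarith, hzb⟩, hF.eq_of_mem_Icc ha h ⟨haz, by linarith⟩]⟩

/-- `lazify f F L` is frozen on the intervals where `F` is, up to a final delay `L`. -/
lemma lazify_const (hf : SlowGrowth f) (hF : SlowGrowth F) (hL : 0 < L) {a b z : ℝ} (ha : 0 ≤ a)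
    (h : F a = F b) (haz : a ≤ z) (hzb : z + L ≤ b) : lazify f F L z = lazify f F L a := by
  rw [lazify_of_mem hf hF (mem_stallSet_of_eq hF hL ha h haz hzb),
    lazify_of_mem hf hF (mem_stallSet_of_eq hF hL ha h le_rfl (by linarith)),
    firstTime_congr (hF.eq_of_mem_Icc ha h ⟨haz, by linarith⟩)]

lemma firstTime_zero (hF : SlowGrowth F) : firstTime F 0 = 0 :=
  le_antisymm (firstTime_spec hF le_rfl).2.1 (firstTime_spec hF le_rfl).1

lemma lt_catchUp (hf : SlowGrowth f) (hF : SlowGrowth F) (hL : 0 < L) (hDL : D < L)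
    (hD : ∀ x y, 0 ≤ x → x ≤ y → F x = F y → f y ≤ f x + D) {t q : ℝ} (ht : t ∈ stallSet F L)
    (hq : t + L ≤ q) : f q < f (firstTime F t) + (q - t) := by
  have hs := firstTime_spec hF ht.1
  have h1 := (hf (x := t + L) (y := q) (by linarith [ht.1]) hq).2
  have h2 := hD (firstTime F t) (t + L) hs.1 (by linarith) (by rw [hs.2.2, ht.2])
  linarith

lemma le_lazify (hf : SlowGrowth f) (hF : SlowGrowth F) (hL : 0 < L) (hD0 : 0 ≤ D) (hDL : D < L)
    (hD : ∀ x y, 0 ≤ x → x ≤ y → F x = F y → f y ≤ f x + D) {q : ℝ} (hq : 0 ≤ q) :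
    f q ≤ lazify f F L q + D := by
  obtain ⟨t, ht, ht0, htq, hmax⟩ := exists_lastStall hF hL hq
  rw [lazify_eq_min ht ht0 htq hmax, ← sub_le_iff_le_add]
  refine le_min (by linarith) ?_
  rcases ht with rfl | ht
  · rw [firstTime_zero hF]
    linarith [(hf le_rfl hq).2]
  · rcases le_total (t + L) q with h | h
    · linarith [lt_catchUp hf hF hL hDL hD ht h]
    · have hs := firstTime_spec hF ht0
      have := hD (firstTime F t) q hs.1 (hs.2.1.trans htq)
        (by rw [hs.2.2, hF.eq_of_mem_Icc ht0 ht.2.symm ⟨htq, h⟩])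
      linarith

lemma lazify_right (hf : SlowGrowth f) (hF : SlowGrowth F) (hL : 0 < L) {q : ℝ} (hq : 0 ≤ q) :
    ∃ r, q < r ∧
      ((q ∈ stallSet F L ∧ ∀ z ∈ Set.Icc q r, lazify f F L z = lazify f F L q) ∨
       (∀ z ∈ Set.Icc q r, lazify f F L z = f z) ∨
       ∃ C, ∀ z ∈ Set.Icc q r, lazify f F L z = z + C) := by
  by_cases hA : q ∈ stallSet F L ∧ ∃ y ∈ stallSet F L, y ∈ Set.Ioo q (q + L)
  · obtain ⟨hqA, y, hyA, hqy, hyL⟩ := hA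
    have h1 : F y = F q := hF.eq_of_mem_Icc hq hqA.2.symm ⟨hqy.le, hyL.le⟩
    exact ⟨y, hqy, Or.inl ⟨hqA, fun z hz =>
      lazify_const hf hF hL hq (b := y + L) (by rw [hyA.2, h1]) hz.1 (by linarith [hz.2])⟩⟩
  · have hgap : ∃ r, q < r ∧ ∀ z ∈ stallSet F L, z ≤ r → z ≤ q := by
      by_cases hqA : q ∈ stallSet F L
      · refine ⟨q + L / 2, by linarith, fun z hz hzr => ?_⟩
        by_contra! hzq
        exact hA ⟨hqA, z, hz, hzq, by linarith⟩
      · have hlt : F q < F (q + L) :=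
          lt_of_le_of_ne (hF hq (by linarith)).1 fun h => hqA ⟨hq, h.symm⟩
        refine ⟨q + (F (q + L) - F q) / 2, by linarith, fun z hz hzr => ?_⟩
        by_contra! hzq
        have h1 := (hF hq hzq.le).2
        have h2 := (hF (x := q + L) (y := z + L) (by linarith) (by linarith)).1
        have h3 := hz.2
        linarith
    obtain ⟨r, hqr, hr⟩ := hgap
    obtain ⟨t, ht, ht0, htq, hmax⟩ := exists_lastStall hF hL hq
    have hG : ∀ z ∈ Set.Icc q r, lazify f F L z = min (f z) (f (firstTime F t) + (z - t)) :=
      fun z hz => lazify_eq_min ht ht0 (htq.trans hz.1) fun w hw hwz =>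
        hmax w hw (hr w hw (hwz.trans hz.2))
    rcases le_or_gt (f q) (f (firstTime F t) + (q - t)) with h | h
    · refine ⟨r, hqr, Or.inr (Or.inl fun z hz => ?_)⟩
      rw [hG z hz]
      exact min_eq_left (by linarith [(hf hq hz.1).2])
    · refine ⟨min r (f q - f (firstTime F t) + t), lt_min hqr (by linarith),
        Or.inr (Or.inr ⟨f (firstTime F t) - t, fun z hz => ?_⟩)⟩
      have hz1 := hz.2.trans (min_le_left _ _)
      have hz2 := hz.2.trans (min_le_right _ _)
      rw [hG z ⟨hz.1, hz1⟩, min_eq_right (by linarith [(hf hq hz.1).1])]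
      ring

lemma lazify_left (hf : SlowGrowth f) (hF : SlowGrowth F) (hL : 0 < L) (hDL : D < L)
    (hD : ∀ x y, 0 ≤ x → x ≤ y → F x = F y → f y ≤ f x + D) {q : ℝ} (hq : 0 < q) :
    ∃ x, 0 ≤ x ∧ x < q ∧
      ((∀ z ∈ Set.Icc x q, lazify f F L z = lazify f F L q) ∨
       (∀ z ∈ Set.Icc x q, lazify f F L z = f z) ∨
       ((q ∈ stallSet F L → lazify f F L q = f q) ∧ ∃ t ∈ stallSet F L, t < q ∧
         ∀ z ∈ Set.Icc x q, lazify f F L z = z + (f (firstTime F t) - t))) := by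
  by_cases hA : q ∈ stallSet F L ∧ ∃ s, 0 ≤ s ∧ s < q ∧ F s = F q
  · obtain ⟨hqA, s, hs0, hsq, hs⟩ := hA
    have h1 : F s = F (q + L) := by rw [hs, hqA.2]
    refine ⟨s, hs0, hsq, Or.inl fun z hz => ?_⟩
    rw [lazify_const hf hF hL hs0 h1 hz.1 (by linarith [hz.2]),
      lazify_const hf hF hL hs0 h1 hsq.le le_rfl]
  · have hfirst : q ∈ stallSet F L → firstTime F q = q := fun hqA => by
      have hs := firstTime_spec hF hq.le
      by_contra hne
      exact hA ⟨hqA, _, hs.1, lt_of_le_of_ne hs.2.1 hne, hs.2.2⟩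
    have hstall : q ∈ stallSet F L → lazify f F L q = f q := fun hqA => by
      rw [lazify_of_mem hf hF hqA, hfirst hqA]
    have hgap : ∃ x, 0 ≤ x ∧ x < q ∧ ∀ z ∈ stallSet F L, z < q → z ≤ x := by
      by_cases hqA : q ∈ stallSet F L
      · refine ⟨max 0 (q - L), le_max_left _ _, max_lt hq (by linarith), fun z hz hzq => ?_⟩
        refine le_max_of_le_right ?_
        by_contra! hzL
        exact hA ⟨hqA, z, hz.1, hzq,
          (hF.eq_of_mem_Icc hz.1 hz.2.symm ⟨hzq.le, by linarith⟩).symm⟩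
      · have hlt : F q < F (q + L) :=
          lt_of_le_of_ne (hF hq.le (by linarith)).1 fun h => hqA ⟨hq.le, h.symm⟩
        refine ⟨max 0 (q - (F (q + L) - F q)), le_max_left _ _, max_lt hq (by linarith),
          fun z hz hzq => le_max_of_le_right ?_⟩
        have h1 := (hF hz.1 hzq.le).1
        have h2 := (hF (x := z + L) (y := q + L) (by linarith [hz.1]) (by linarith)).2
        have h3 := hz.2
        linarith
    obtain ⟨x, hx0, hxq, hx⟩ := hgap
    obtain ⟨t, ht, ht0, htx, hmax⟩ := exists_lastStall hF hL hx0
    have htq : t < q := htx.trans_lt hxq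
    have hG : ∀ z ∈ Set.Icc x q, lazify f F L z = min (f z) (f (firstTime F t) + (z - t)) := by
      intro z hz
      by_cases hzA : z = q ∧ q ∈ stallSet F L
      · obtain ⟨rfl, hqA⟩ := hzA
        rw [hstall hqA, min_eq_left]
        rcases ht with rfl | ht
        · rw [firstTime_zero hF]
          linarith [(hf le_rfl hq.le).2]
        · refine (lt_catchUp hf hF hL hDL hD ht ?_).le
          by_contra! h
          exact hA ⟨hqA, t, ht0, htq, (hF.eq_of_mem_Icc ht0 ht.2.symm ⟨htq.le, h.le⟩).symm⟩
      · refine lazify_eq_min ht ht0 (htx.trans hz.1) fun w hw hwz => hmax w hw (hx w hw ?_)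
        refine lt_of_le_of_ne (hwz.trans hz.2) ?_
        rintro rfl
        exact hzA ⟨le_antisymm hz.2 hwz, hw⟩
    rcases lt_or_ge (f q) (f (firstTime F t) + (q - t)) with h | h
    · refine ⟨max x (f q - f (firstTime F t) + t), hx0.trans (le_max_left _ _),
        max_lt hxq (by linarith), Or.inr (Or.inl fun z hz => ?_)⟩
      have hz1 := (le_max_left _ _).trans hz.1
      have hz2 := (le_max_right _ _).trans hz.1
      rw [hG z ⟨hz1, hz.2⟩, min_eq_left (by linarith [(hf (hx0.trans hz1) hz.2).1])]
    · have hline : ∀ z ∈ Set.Icc x q, f (firstTime F t) + (z - t) ≤ f z := fun z hz => by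
        linarith [(hf (hx0.trans hz.1) hz.2).2]
      refine ⟨x, hx0, hxq, Or.inr ?_⟩
      rcases ht with rfl | ht
      · refine Or.inl fun z hz => ?_
        rw [hG z hz, min_eq_left]
        rw [firstTime_zero hF]
        linarith [(hf le_rfl (hx0.trans hz.1)).2]
      · refine Or.inr ⟨hstall, t, ht, htq, fun z hz => ?_⟩
        rw [hG z hz, min_eq_right (hline z hz)]
        ring

lemma hasDerivWithinAt_add_const_one (C q : ℝ) (s : Set ℝ) :
    HasDerivWithinAt (fun z => z + C) 1 s q := (hasDerivWithinAt_id q s).add_const C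

lemma lazify_slope01On (hfs : Slope01On f 0) (hF : SlowGrowth F) (hL : 0 < L) (hDL : D < L)
    (hD : ∀ x y, 0 ≤ x → x ≤ y → F x = F y → f y ≤ f x + D) :
    Slope01On (lazify f F L) 0 := by
  have hf := hfs.slowGrowth hfs.continuousOn
  constructor
  · intro q hq
    obtain ⟨r, hr, ⟨-, h⟩ | h | ⟨C, h⟩⟩ := lazify_right hf hF hL hq
    · exact Or.inl ((hasDerivWithinAt_const _ _ _).congr_Icc_right hr h)
    · exact (hfs.1 q hq).imp (·.congr_Icc_right hr h) (·.congr_Icc_right hr h)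
    · exact Or.inr ((hasDerivWithinAt_add_const_one _ _ _).congr_Icc_right hr h)
  · intro q hq
    obtain ⟨x, hx0, hx, h | h | ⟨-, t, -, -, h⟩⟩ := lazify_left hf hF hL hDL hD hq
    · exact Or.inl ((hasDerivWithinAt_const _ _ _).congr_Icc_left hx0 hx h)
    · exact (hfs.2 q hq).imp (·.congr_Icc_left hx0 hx h) (·.congr_Icc_left hx0 hx h)
    · exact Or.inr ((hasDerivWithinAt_add_const_one _ _ _).congr_Icc_left hx0 hx h)

/-- Where `lazify f F L` changes slope from `1` to `0`, it agrees with `f`, and `f` itself changes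
slope at some point of the same interval of constancy of `F`. -/
lemma lazify_changesSlopeOn (hfs : Slope01On f 0) (hF : SlowGrowth F) (hL : 0 < L) (hD0 : 0 ≤ D)
    (hDL : D < L) (hD : ∀ x y, 0 ≤ x → x ≤ y → F x = F y → f y ≤ f x + D) {q : ℝ} (hq : 0 < q)
    (hch : ChangesSlopeOn (lazify f F L) 0 q) :
    lazify f F L q = f q ∧ ∃ c, 0 < c ∧ F c = F q ∧ ChangesSlopeOn f 0 c := by
  have hf := hfs.slowGrowth hfs.continuousOn
  obtain ⟨hl, hr⟩ := hch
  obtain ⟨x, hx0, hx, hleft⟩ := lazify_left hf hF hL hDL hD hq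
  obtain ⟨r, hqr, hright⟩ := lazify_right hf hF hL hq.le
  have hxq : q ∈ Set.Icc x q := Set.right_mem_Icc.2 hx.le
  have hqm : q ∈ Set.Icc q r := Set.left_mem_Icc.2 hqr.le
  replace hleft := hleft.resolve_left fun h => zero_ne_one <|
    ((hasDerivWithinAt_const q (Set.Icc 0 q) _).congr_Icc_left hx0 hx h).unique_Icc hq hl
  have hright' : q ∈ stallSet F L ∨ ∀ z ∈ Set.Icc q r, lazify f F L z = f z := by
    rcases hright with h | h | ⟨C, h⟩
    · exact Or.inl h.1
    · exact Or.inr h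
    · exact absurd (((hasDerivWithinAt_add_const_one _ _ _).congr_Icc_right hqr h).unique_Ici hr)
        one_ne_zero
  have hGq : lazify f F L q = f q := by
    rcases hleft with h | h
    · exact h q hxq
    · exact hright'.elim h.1 fun h => h q hqm
  refine ⟨hGq, ?_⟩
  rcases hfs.1 q hq.le with h0 | h1
  · rcases hleft with h | ⟨-, t, ht, htq, h⟩
    · exact ⟨q, hq, rfl, hl.congr_Icc_left hx0 hx fun z hz => (h z hz).symm, h0⟩
    · have hs := firstTime_spec hF ht.1
      have hfq : f q = f (firstTime F t) + (q - t) := by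
        rw [← hGq, h q hxq]
        ring
      have hqt : q ≤ t + L := by
        by_contra! hlt
        exact (lt_catchUp hf hF hL hDL hD ht hlt.le).ne hfq
      have hFq : F (firstTime F t) = F q := by
        rw [hs.2.2, hF.eq_of_mem_Icc ht.1 ht.2.symm ⟨htq.le, hqt⟩]
      set s := firstTime F t
      have hsq : s < q := hs.2.1.trans_lt htq
      obtain ⟨c, hc, hcc⟩ := hfs.exists_changesSlopeOn (θ := (q - t) / (q - s) / 2) hs.1
        (by have := sub_pos.2 htq; have := sub_pos.2 hsq; positivity)
        (by
          have : (q - t) / (q - s) ≤ 1 := (div_le_one (by linarith)).2 (by linarith [hs.2.1])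
          linarith)
        (Set.right_mem_Icc.2 hsq.le)
        (by
          have : (q - t) / (q - s) / 2 * (q - s) = (q - t) / 2 := by
            field_simp [(sub_pos.2 hsq).ne']
          rw [this]
          linarith) (Or.inr h0)
      exact ⟨c, hs.1.trans_lt hc.1,
        (hF.eq_of_mem_Icc hs.1 hFq ⟨hc.1.le, hc.2⟩).trans hFq, hcc⟩
  · have hqA : q ∈ stallSet F L := hright'.resolve_right fun h =>
      one_ne_zero ((h1.congr_Icc_right hqr h).unique_Ici hr)
    have hdl := hD q (q + L) hq.le (by linarith) hqA.2.symm
    obtain ⟨θ, hθD, hθ1⟩ := exists_between ((div_lt_one hL).2 hDL)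
    have hθ0 : 0 < θ := (div_nonneg hD0 hL.le).trans_lt hθD
    have hlead : ∃ z ∈ Set.Icc q (q + L), θ * (z - q) < f z - f q := by
      have h2 := (hasDerivWithinAt_iff_tendsto_slope' (by simp)).1
        (h1.mono Set.Ioi_subset_Ici_self)
      obtain ⟨z, hz, hzθ⟩ := ((eventually_of_mem (Ioc_mem_nhdsGT (show q < q + L by linarith))
        fun _ h => h).and (h2.eventually (lt_mem_nhds hθ1))).exists
      refine ⟨z, ⟨hz.1.le, hz.2⟩, ?_⟩
      rw [slope_def_field, lt_div_iff₀ (sub_pos.2 hz.1)] at hzθ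
      exact hzθ
    obtain ⟨z, hz, hzθ⟩ := hlead
    obtain ⟨c, hc, hcc⟩ := hfs.exists_changesSlopeOn hq.le hθ0 hθ1 hz hzθ
      (Or.inl (by
        rw [div_lt_iff₀ hL] at hθD
        linarith))
    exact ⟨c, hq.trans hc.1, hF.eq_of_mem_Icc hq.le hqA.2.symm ⟨hc.1.le, hc.2⟩, hcc⟩

end lazify

lemma Msum_zero {n : ℕ} (P : ℝ → Fin n → ℝ) : Msum P 0 = fun _ => 0 := by
  funext q
  simp [Msum]

lemma Msum_succ {n : ℕ} (P : ℝ → Fin n → ℝ) {j : ℕ} (hj : j < n) (q : ℝ) :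
    Msum P (j + 1) q = Msum P j q + P q ⟨j, hj⟩ := by
  have : Finset.univ.filter (fun i : Fin n => (i : ℕ) < j + 1) =
      insert ⟨j, hj⟩ (Finset.univ.filter fun i : Fin n => (i : ℕ) < j) := by
    ext i
    simp only [Finset.mem_filter, Finset.mem_univ, true_and, Finset.mem_insert, Fin.ext_iff]
    omega
  rw [Msum, this, Finset.sum_insert (by simp), add_comm, Msum]

lemma Msum_sub {n : ℕ} {N : ℕ → ℝ → ℝ} (h0 : N 0 = fun _ => 0) {j : ℕ} (hj : j ≤ n) :
    Msum (fun q (i : Fin n) => N (i + 1) q - N i q) j = N j := by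
  induction j with
  | zero => rw [Msum_zero, h0]
  | succ j ih =>
    funext q
    rw [Msum_succ _ hj, ih (by omega)]
    ring

/-- Successive lazy versions of the partial sums of `P`, starting from the full sum. -/
def lazySum {n : ℕ} (P : ℝ → Fin n → ℝ) (L : ℝ) : ℕ → ℝ → ℝ
  | 0 => Msum P n
  | k + 1 => lazify (Msum P (n - (k + 1))) (lazySum P L k) L

lemma exists_lazy_sums {n : ℕ} (hn : 0 < n) (P : ℝ → Fin n → ℝ) (L : ℝ) :
    ∃ N : ℕ → ℝ → ℝ, N 0 = (fun _ => 0) ∧ N n = Msum P n ∧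
      ∀ i, 1 ≤ i → i < n → N i = lazify (Msum P i) (N (i + 1)) L := by
  refine ⟨fun i => if i = 0 then fun _ => 0 else lazySum P L (n - i), by simp, ?_, ?_⟩
  · simp [hn.ne', lazySum]
  · intro i hi hin
    have h1 : n - i = (n - (i + 1)) + 1 := by omega
    have h2 : n - (n - (i + 1) + 1) = i := by omega
    simp only [Nat.add_eq_zero_iff, one_ne_zero, and_false, if_false,
      (Nat.one_le_iff_ne_zero.1 hi)]
    rw [h1, lazySum, h2]

section systems

variable {n : ℕ} {γ : ℝ} {P : ℝ → Fin n → ℝ} {N : ℕ → ℝ → ℝ}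

lemma IsNSystem.slowGrowth (hP : IsNSystem n γ 0 P) {j : ℕ} (hj : j ≤ n) :
    SlowGrowth (Msum P j) :=
  (hP.2.2.2.1 j hj).2.slowGrowth (hP.2.2.2.1 j hj).1

/-- While a function within `kγ` of `P_1 + ⋯ + P_{i+1}` is constant, `P_1 + ⋯ + P_i` grows by at
most `(k+1)γ`. -/
lemma IsNSystem.drift (hP : IsNSystem n γ 0 P) {i : ℕ} (hi : i < n) {F : ℝ → ℝ} {k : ℝ}
    (hF : ∀ q, 0 ≤ q → F q ≤ Msum P (i + 1) q ∧ Msum P (i + 1) q ≤ F q + k * γ) (x y : ℝ)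
    (hx : 0 ≤ x) (hxy : x ≤ y) (h : F x = F y) : Msum P i y ≤ Msum P i x + (k + 1) * γ := by
  have h1 := hF x hx
  have h2 := hF y (hx.trans hxy)
  have h3 := hP.2.2.1 ⟨i, hi⟩ x y hx hxy
  rw [Msum_succ P hi] at h1 h2
  linarith

lemma lazy_sums_spec (hγ : 0 < γ) (hP : IsNSystem n γ 0 P) (h0 : N 0 = fun _ => 0)
    (hNn : N n = Msum P n)
    (hN : ∀ i, 1 ≤ i → i < n → N i = lazify (Msum P i) (N (i + 1)) ((n + 1) * γ)) {i : ℕ}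
    (hi : i ≤ n) :
    Slope01On (N i) 0 ∧
      ∀ q, 0 ≤ q → N i q ≤ Msum P i q ∧ Msum P i q ≤ N i q + (n - i) * γ := by
  induction hi using Nat.decreasingInduction with
  | self =>
    rw [hNn]
    exact ⟨(hP.2.2.2.1 n le_rfl).2, fun q _ => by simp⟩
  | of_succ i hi ih =>
    have hin : (i : ℝ) + 1 ≤ n := by exact_mod_cast hi
    rcases Nat.eq_zero_or_pos i with rfl | hpos
    · rw [h0, Msum_zero]
      refine ⟨⟨fun q _ => Or.inl (hasDerivWithinAt_const _ _ _),
        fun q _ => Or.inl (hasDerivWithinAt_const _ _ _)⟩, fun q _ => ⟨le_rfl, ?_⟩⟩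
      push_cast
      have := mul_nonneg n.cast_nonneg hγ.le
      linarith
    obtain ⟨hs, hb⟩ := ih
    have hF := hs.slowGrowth hs.continuousOn
    have hf := hP.slowGrowth hi.le
    have hD := hP.drift hi hb
    have hL : 0 < ((n : ℝ) + 1) * γ := by positivity
    have hDk : ((n : ℝ) - (i + 1 : ℕ) + 1) * γ = (n - i) * γ := by push_cast; ring
    rw [hDk] at hD
    have hD0 : 0 ≤ ((n : ℝ) - i) * γ := mul_nonneg (by linarith) hγ.le
    have hDL : ((n : ℝ) - i) * γ < (n + 1) * γ :=
      mul_lt_mul_of_pos_right (by linarith [i.cast_nonneg (α := ℝ)]) hγ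
    rw [hN i hpos hi]
    exact ⟨lazify_slope01On (hP.2.2.2.1 i hi.le).2 hF hL hDL hD, fun q hq =>
      ⟨lazify_le q, le_lazify hf hF hL hD0 hDL hD hq⟩⟩

lemma lazy_sums_changesSlopeOn (hγ : 0 < γ) (hP : IsNSystem n γ 0 P) (h0 : N 0 = fun _ => 0)
    (hNn : N n = Msum P n)
    (hN : ∀ i, 1 ≤ i → i < n → N i = lazify (Msum P i) (N (i + 1)) ((n + 1) * γ)) {j : ℕ}
    (hj1 : 1 ≤ j) (hj : j < n) {q : ℝ} (hq : 0 < q) (hch : ChangesSlopeOn (N j) 0 q) :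
    N j q = Msum P j q ∧
      P q ⟨j, hj⟩ ≤ P q ⟨j - 1, by omega⟩ + (n - j + 2) * γ := by
  have hjn : (j : ℝ) + 1 ≤ n := by exact_mod_cast hj
  obtain ⟨hs, hb⟩ := lazy_sums_spec hγ hP h0 hNn hN (i := j + 1) hj
  have hF := hs.slowGrowth hs.continuousOn
  have hD := hP.drift hj hb
  have hL : 0 < ((n : ℝ) + 1) * γ := by positivity
  have hDk : ((n : ℝ) - (j + 1 : ℕ) + 1) * γ = (n - j) * γ := by push_cast; ring
  rw [hDk] at hD
  have hD0 : 0 ≤ ((n : ℝ) - j) * γ := mul_nonneg (by linarith) hγ.le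
  have hDL : ((n : ℝ) - j) * γ < (n + 1) * γ :=
    mul_lt_mul_of_pos_right (by linarith [j.cast_nonneg (α := ℝ)]) hγ
  rw [hN j hj1 hj] at hch ⊢
  obtain ⟨hG, c, hc0, hFc, hc⟩ :=
    lazify_changesSlopeOn (hP.2.2.2.1 j hj.le).2 hF hL hD0 hDL hD hq hch
  refine ⟨hG, ?_⟩
  have hPc := hP.2.2.2.2.2 j hj1 hj c hc0 hc
  have hMq := Msum_succ P (show j - 1 < n by omega) q
  have hMc := Msum_succ P (show j - 1 < n by omega) c
  rw [Nat.sub_add_cancel hj1] at hMq hMc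
  rcases le_total c q with hcq | hcq
  · have h1 := hP.2.2.1 ⟨j - 1, by omega⟩ c q hc0.le hcq
    have h2 := (hP.slowGrowth hj.le hc0.le hcq).1
    have h3 := hb c hc0.le
    have h4 := hb q hq.le
    rw [Msum_succ P hj] at h3 h4
    push_cast at h3 h4
    linarith
  · have h1 := hP.2.2.1 ⟨j, hj⟩ q c hq.le hcq
    have h2 := hD q c hq.le hcq hFc.symm
    have h3 := (hP.slowGrowth (show j - 1 ≤ n by omega) hq.le hcq).1
    linarith

lemma lazy_sums_const (hγ : 0 < γ) (hP : IsNSystem n γ 0 P) (h0 : N 0 = fun _ => 0)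
    (hNn : N n = Msum P n)
    (hN : ∀ i, 1 ≤ i → i < n → N i = lazify (Msum P i) (N (i + 1)) ((n + 1) * γ)) {j : ℕ}
    (hj : j ≤ n) {a b : ℝ} (ha : 0 ≤ a) (hab : ∀ q ∈ Set.Icc a b, N j q = N j a) {i : ℕ}
    (hi : i ≤ j) :
    ∀ q ∈ Set.Icc a (b - (j - i) * ((n + 1) * γ)), N i q = N i a := by
  induction hi using Nat.decreasingInduction with
  | self => simpa using hab
  | of_succ i hi ih =>
    have hin : i < n := hi.trans_le hj
    intro q hq
    rcases Nat.eq_zero_or_pos i with rfl | hpos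
    · rw [h0]
    obtain ⟨hs, -⟩ := lazy_sums_spec hγ hP h0 hNn hN (i := i + 1) hin
    have hL : 0 < ((n : ℝ) + 1) * γ := by positivity
    rw [hN i hpos hin]
    refine lazify_const (hP.slowGrowth hin.le) (hs.slowGrowth hs.continuousOn) hL ha
      (ih (q + (n + 1) * γ) ⟨by linarith [hq.1], ?_⟩).symm hq.1 le_rfl
    have := hq.2
    push_cast
    linarith

lemma isReducedSystem_of_zero (hP : IsNSystem n 0 0 P) : IsReducedSystem n 0 0 P := by
  refine ⟨hP, fun j _ _ a b ha _ hc i hi q hq => ?_⟩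
  have hmono : ∀ i ∈ Finset.univ.filter (fun i : Fin n => (i : ℕ) < j), P a i ≤ P q i :=
    fun i _ => by simpa using hP.2.2.1 i a q ha hq.1
  have hsum := hc q ⟨hq.1, by simpa using hq.2⟩
  exact ((Finset.sum_eq_sum_iff_of_le hmono).1 hsum.symm i (by simpa using hi)).symm

end systems

/-- Let `γ ≥ 0` and let `P` be an `(n,γ)`-system on
`[0,∞)`.  Then there exists an `(n,2nγ)`-reduced system `P̃` on `[0,∞)` with
`‖P(q) − P̃(q)‖_∞ ≤ nγ` for all `q ≥ 0`. -/
theorem stmt18 (n : ℕ) (hn : 2 ≤ n) (γ : ℝ) (hγ : 0 ≤ γ)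
    (P : ℝ → Fin n → ℝ) (hP : IsNSystem n γ 0 P) :
    ∃ Pt : ℝ → Fin n → ℝ, IsReducedSystem n (2 * n * γ) 0 Pt ∧
      ∀ q : ℝ, 0 ≤ q → ∀ j : Fin n, |P q j - Pt q j| ≤ n * γ := by
  rcases hγ.eq_or_lt with rfl | hγ
  · refine ⟨P, ?_, fun q _ j => by simp⟩
    simpa using isReducedSystem_of_zero hP
  obtain ⟨N, h0, hNn, hN⟩ := exists_lazy_sums (by omega : 0 < n) P ((n + 1) * γ)
  have hspec := fun i hi => lazy_sums_spec hγ hP h0 hNn hN (i := i) hi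
  have hn' : (2 : ℝ) ≤ n := by exact_mod_cast hn
  have hnγ : 2 * γ ≤ n * γ := mul_le_mul_of_nonneg_right hn' hγ.le
  have hPM : ∀ q (j : Fin n), P q j = Msum P (j + 1) q - Msum P j q := fun q j => by
    rw [Msum_succ P j.2]
    ring
  have hjγ : ∀ j : ℕ, 0 ≤ (j : ℝ) * γ := fun j => mul_nonneg j.cast_nonneg hγ.le
  -- the deviations of the lazy sums from the partial sums of `P`
  have hdev : ∀ q, 0 ≤ q → ∀ i, i ≤ n →
      0 ≤ Msum P i q - N i q ∧ Msum P i q - N i q + i * γ ≤ n * γ := fun q hq i hi => by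
    have := (hspec i hi).2 q hq
    constructor <;> linarith
  have hdevs : ∀ q, 0 ≤ q → ∀ j : Fin n, Msum P (j + 1) q - N (j + 1) q + j * γ + γ ≤ n * γ :=
    fun q hq j => by
      have := (hdev q hq (j + 1) j.2).2
      push_cast at this
      linarith
  set Pt : ℝ → Fin n → ℝ := fun q i => N (i + 1) q - N i q with hPt
  have hMt : ∀ j, j ≤ n → Msum Pt j = N j := fun j hj => Msum_sub h0 hj
  refine ⟨Pt, ⟨⟨?_, ?_, ?_, ?_, ?_, ?_⟩, ?_⟩, ?_⟩
  · intro q hq j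
    have h1 := hP.1 q hq j
    have h2 := hdev q hq j j.2.le
    have h3 := hdev q hq (j + 1) j.2
    have h4 := hdevs q hq j
    have := hjγ j
    rw [hPM] at h1
    simp only [hPt]
    linarith
  · intro q hq j hj
    have h1 := hP.2.1 q hq j hj
    have h2 := hdev q hq j j.2.le
    have h3 := hdev q hq (j + 1) j.2
    have h4 := hdevs q hq ⟨j + 1, hj⟩
    have := hjγ j
    rw [hPM, hPM q ⟨j + 1, hj⟩] at h1
    simp only [hPt] at h1 h4 ⊢
    push_cast at h4
    linarith
  · intro j q₁ q₂ hq₁ hq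
    have h1 := hP.2.2.1 j q₁ q₂ hq₁ hq
    have h2 := hdev q₁ hq₁ j j.2.le
    have h3 := hdev q₁ hq₁ (j + 1) j.2
    have h4 := hdev q₂ (hq₁.trans hq) j j.2.le
    have h5 := hdevs q₂ (hq₁.trans hq) j
    have := hjγ j
    rw [hPM, hPM q₂] at h1
    simp only [hPt]
    linarith
  · intro j hj
    rw [hMt j hj]
    exact ⟨(hspec j hj).1.continuousOn, (hspec j hj).1⟩
  · intro q hq
    rw [hMt n le_rfl, hNn]
    exact hP.2.2.2.2.1 q hq
  · intro j hj1 hj q hq hch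
    rw [hMt j hj.le] at hch
    obtain ⟨h1, h2⟩ := lazy_sums_changesSlopeOn hγ hP h0 hNn hN hj1 hj hq hch
    have h3 := (hdev q hq.le (j + 1) hj).1
    have h4 := (hdev q hq.le (j - 1) (by omega)).1
    have h5 : γ ≤ j * γ := le_mul_of_one_le_left hγ.le (by exact_mod_cast hj1)
    rw [hPM, hPM q ⟨j - 1, _⟩] at h2
    simp only [hPt, Nat.sub_add_cancel hj1] at h2 ⊢
    linarith
  · intro j hj1 hj a b ha hab hc i hi q hq
    rw [hMt j hj.le] at hc
    have hjn : (j : ℝ) ≤ n - 1 := by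
      have : (j : ℝ) + 1 ≤ n := by exact_mod_cast hj
      linarith
    have hlag : ∀ i : ℕ, ((j : ℝ) - i) * ((n + 1) * γ) ≤ n * (2 * n * γ) := fun i => by
      have h1 : ((j : ℝ) - i) * ((n + 1) * γ) ≤ (n - 1) * ((n + 1) * γ) :=
        mul_le_mul_of_nonneg_right (by linarith [i.cast_nonneg (α := ℝ)]) (by positivity)
      have h2 : 0 ≤ (n : ℝ) * n * γ := by positivity
      linarith
    have hconst : ∀ i, i ≤ j → N i q = N i a := fun i hi =>
      lazy_sums_const hγ hP h0 hNn hN hj.le ha hc hi q ⟨hq.1, hq.2.trans (by linarith [hlag i])⟩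
    simp only [hPt]
    rw [hconst i hi.le, hconst (i + 1) hi]
  · intro q hq j
    have h2 := hdev q hq j j.2.le
    have h3 := hdev q hq (j + 1) j.2
    have h4 := hdevs q hq j
    have := hjγ j
    rw [hPM, abs_le]
    simp only [hPt]
    constructor <;> linarith
end
end
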